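/- Let τ = (τ1, τ2) ∈ ℝ² with τ1 ≥ τ2 ≥ 0 and τ1 + τ2 > 1. Then for any ball B ⊆ [0,1]² of positive radius, the Hausdorff dimension of B ∩ B_2(Ψ_τ) equals the Hausdorff dimension of A_2(Ψ_τ), and both equal min{(3 + τ1 − τ2)/(1 + τ1), 3/(1 + τ2)}. -/

import Mathlib

open MeasureTheory Set

noncomputable section

/-- The set of Ψ-approximable vectors in `[0,1]^m`: points `x` such that for infinitely many
positive integers `q` there exists `p ∈ ℤ^m` with `|q * x i - p i| < Ψ q i` for all `i`. -/
def approxSet (m : ℕ) (Ψ : ℕ → Fin m → ℝ) : Set (Fin m → ℝ) :=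
  {x | (∀ i, x i ∈ Set.Icc (0:ℝ) 1) ∧
    {q : ℕ | 0 < q ∧ ∃ p : Fin m → ℤ,
      ∀ i, |(q : ℝ) * x i - (p i : ℝ)| < Ψ q i}.Infinite}

/-- The set of weighted Ψ-badly approximable vectors:
`B_m(Ψ) = A_m(Ψ) \ ⋂_{0<c<1} A_m(cΨ)`. -/
def badSet (m : ℕ) (Ψ : ℕ → Fin m → ℝ) : Set (Fin m → ℝ) :=
  approxSet m Ψ \ ⋂ c ∈ Set.Ioo (0:ℝ) 1, approxSet m (fun q i => c * Ψ q i)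

/-- The power-law approximation function `Ψ_τ`, with `ψ_i(q) = q^{-τ_i}`. -/
def psiTau (m : ℕ) (τ : Fin m → ℝ) : ℕ → Fin m → ℝ :=
  fun q i => (q : ℝ) ^ (-(τ i))

lemma card_Icc_erase_zero_le {L : ℝ} (hL : 0 ≤ L) :
    ((((Finset.Icc (-⌊L⌋) ⌊L⌋).erase 0).card : ℕ) : ℝ) ≤ 2 * L := by
  have h0 : (0 : ℤ) ≤ ⌊L⌋ := Int.floor_nonneg.2 hL
  have hmem : (0 : ℤ) ∈ Finset.Icc (-⌊L⌋) ⌊L⌋ := by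
    rw [Finset.mem_Icc]; constructor <;> omega
  rw [Finset.card_erase_of_mem hmem, Int.card_Icc]
  have h1 : (((⌊L⌋ + 1 - -⌊L⌋).toNat - 1 : ℕ) : ℤ) = 2 * ⌊L⌋ := by omega
  have h2 : (((⌊L⌋ + 1 - -⌊L⌋).toNat - 1 : ℕ) : ℝ) = 2 * (⌊L⌋ : ℝ) := by exact_mod_cast h1
  rw [h2]
  linarith [Int.floor_le L]

/-- The number of pairs `(p, p')` with `0 < p < q` for which `p / q` and `p' / q'` are distinct and
close to one another. -/
lemma card_close_pairs_le {q : ℕ} (hq : q.Prime) (q' : ℕ) {L : ℝ} (hL : 0 ≤ L)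
    (S : Finset (ℕ × ℤ))
    (hS : ∀ z ∈ S, 0 < z.1 ∧ z.1 < q ∧ (q : ℤ) * z.2 - q' * z.1 ≠ 0 ∧
      |(((q : ℤ) * z.2 - q' * z.1 : ℤ) : ℝ)| ≤ L) : (S.card : ℝ) ≤ 2 * L := by
  have hq0 : (0 : ℝ) < q := by exact_mod_cast hq.pos
  have habs : ∀ (k : ℤ) (M : ℝ), |(k : ℝ)| ≤ M → k ∈ Finset.Icc (-⌊M⌋) ⌊M⌋ := by
    intro k M h
    rw [abs_le] at h
    rw [Finset.mem_Icc]
    refine ⟨?_, Int.le_floor.2 h.2⟩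
    have : -k ≤ ⌊M⌋ := Int.le_floor.2 (by push_cast; linarith)
    omega
  by_cases hd : q ∣ q'
  · obtain ⟨m, rfl⟩ := hd
    have hLq : 0 ≤ L / q := by positivity
    have hcard : S.card ≤ (Finset.range q ×ˢ ((Finset.Icc (-⌊L / q⌋) ⌊L / q⌋).erase 0)).card := by
      refine Finset.card_le_card_of_injOn (fun z => (z.1, z.2 - m * z.1)) ?_ ?_
      · intro z hz
        obtain ⟨h1, h2, h3, h4⟩ := hS z hz
        have e : (q : ℤ) * z.2 - ((q * m : ℕ) : ℤ) * z.1 = q * (z.2 - m * z.1) := by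
          push_cast; ring
        rw [e] at h3 h4
        simp only [Finset.coe_product, Set.mem_prod, Finset.mem_coe, Finset.mem_range,
          Finset.mem_erase]
        refine ⟨h2, right_ne_zero_of_mul h3, habs _ _ ?_⟩
        rw [le_div_iff₀ hq0]
        push_cast at h4 ⊢
        rw [abs_mul, abs_of_pos hq0] at h4
        linarith
      · intro z _ w _ h
        simp only [Prod.mk.injEq] at h
        obtain ⟨h1, h2⟩ := h
        rw [h1] at h2
        exact Prod.ext h1 (by linarith)
    rw [Finset.card_product, Finset.card_range] at hcard
    calc (S.card : ℝ) ≤ q * ((((Finset.Icc (-⌊L / q⌋) ⌊L / q⌋).erase 0).card : ℕ) : ℝ) := by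
          exact_mod_cast hcard
      _ ≤ q * (2 * (L / q)) := by gcongr; exact card_Icc_erase_zero_le hLq
      _ = 2 * L := by field_simp
  · have hcard : S.card ≤ ((Finset.Icc (-⌊L⌋) ⌊L⌋).erase 0).card := by
      refine Finset.card_le_card_of_injOn (fun z => (q : ℤ) * z.2 - q' * z.1) ?_ ?_
      · intro z hz
        obtain ⟨h1, h2, h3, h4⟩ := hS z hz
        simp only [Finset.mem_coe, Finset.mem_erase]
        exact ⟨h3, habs _ _ h4⟩
      · intro z hz w hw h
        obtain ⟨hz1, hz2, -, -⟩ := hS z hz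
        obtain ⟨hw1, hw2, -, -⟩ := hS w hw
        simp only at h
        have hdvd : (q : ℤ) ∣ q' * ((z.1 : ℤ) - w.1) := ⟨z.2 - w.2, by linarith⟩
        have hdvd2 : (q : ℤ) ∣ (z.1 : ℤ) - w.1 := by
          rcases (Nat.prime_iff_prime_int.1 hq).dvd_or_dvd hdvd with h' | h'
          · exact absurd (Int.natCast_dvd_natCast.1 h') hd
          · exact h'
        have he : (z.1 : ℤ) - w.1 = 0 := by
          refine Int.eq_zero_of_abs_lt_dvd hdvd2 ?_
          rw [abs_lt]; omega
        have h1 : (z.1 : ℤ) = w.1 := by omega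
        rw [h1] at h
        have hq0' : (q : ℤ) ≠ 0 := by exact_mod_cast hq.ne_zero
        have h2 : z.2 = w.2 := mul_left_cancel₀ hq0' (by linarith)
        exact Prod.ext (by exact_mod_cast h1) h2
    exact (Nat.cast_le.2 hcard).trans (card_Icc_erase_zero_le hL)

/-- A smooth nonnegative function of integral one supported in `[1/4, 1/2]`. -/
def unitBump : ℝ → ℝ :=
  (⟨1 / 16, 1 / 8, by norm_num, by norm_num⟩ : ContDiffBump (3 / 8 : ℝ)).normed volume

lemma unitBump_continuous : Continuous unitBump := ContDiffBump.continuous_normed _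

lemma unitBump_nonneg (u : ℝ) : 0 ≤ unitBump u := ContDiffBump.nonneg_normed _ _

lemma unitBump_integral : ∫ u, unitBump u = 1 := ContDiffBump.integral_normed _

lemma unitBump_integrable : Integrable unitBump := ContDiffBump.integrable_normed _

lemma unitBump_le (u : ℝ) : unitBump u ≤ 8 := by
  have := ContDiffBump.normed_le_div_measure_closedBall_rIn
    (⟨1 / 16, 1 / 8, by norm_num, by norm_num⟩ : ContDiffBump (3 / 8 : ℝ)) volume u
  refine this.trans (le_of_eq ?_)
  rw [Real.volume_real_closedBall (by norm_num)]
  norm_num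

lemma mem_of_unitBump_ne_zero {u : ℝ} (hu : unitBump u ≠ 0) : u ∈ Icc (1 / 4 : ℝ) (1 / 2) := by
  have h : u ∈ Function.support unitBump := hu
  unfold unitBump at h
  rw [ContDiffBump.support_normed_eq, Metric.mem_ball, Real.dist_eq, abs_lt] at h
  simp only at h
  constructor <;> linarith [h.1, h.2]

/-- A bump of mass `1 / q` supported slightly to the right of `p / q`, at distance comparable with
`q ^ (-1 - τ)`. -/
def bumpAt (τ : ℝ) (q p : ℕ) (t : ℝ) : ℝ :=
  (q : ℝ) ^ τ * unitBump ((q : ℝ) ^ τ * (q * t - p))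

/-- The sum of the bumps attached to the fractions `p / q` with `0 < p < q`. -/
def bumpSum (τ : ℝ) (q : ℕ) (t : ℝ) : ℝ := ∑ p ∈ Finset.Ioo 0 q, bumpAt τ q p t

lemma bumpAt_continuous (τ : ℝ) (q p : ℕ) : Continuous (bumpAt τ q p) := by
  unfold bumpAt
  exact continuous_const.mul (unitBump_continuous.comp (by fun_prop))

lemma bumpSum_continuous (τ : ℝ) (q : ℕ) : Continuous (bumpSum τ q) := by
  unfold bumpSum
  exact continuous_finsetSum _ fun p _ => bumpAt_continuous τ q p

lemma bumpAt_nonneg (τ : ℝ) (q p : ℕ) (t : ℝ) : 0 ≤ bumpAt τ q p t :=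
  mul_nonneg (by positivity) (unitBump_nonneg _)

lemma bumpSum_nonneg (τ : ℝ) (q : ℕ) (t : ℝ) : 0 ≤ bumpSum τ q t :=
  Finset.sum_nonneg fun p _ => bumpAt_nonneg τ q p t

lemma bumpAt_le (τ : ℝ) (q p : ℕ) (t : ℝ) : bumpAt τ q p t ≤ 8 * (q : ℝ) ^ τ := by
  unfold bumpAt
  rw [mul_comm]
  exact mul_le_mul_of_nonneg_right (unitBump_le _) (by positivity)

lemma mem_of_bumpAt_ne_zero {τ : ℝ} {q p : ℕ} (hq : 0 < q) {t : ℝ} (h : bumpAt τ q p t ≠ 0) :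
    (q : ℝ) * t - p ∈ Icc (1 / 4 * (q : ℝ) ^ (-τ)) (1 / 2 * (q : ℝ) ^ (-τ)) := by
  have hq0 : (0 : ℝ) < q := by exact_mod_cast hq
  have h1 := mem_of_unitBump_ne_zero (right_ne_zero_of_mul h)
  have h2 : (0 : ℝ) < (q : ℝ) ^ τ := by positivity
  rw [Real.rpow_neg hq0.le]
  constructor
  · rw [← div_eq_mul_inv, div_le_iff₀ h2]; linarith [h1.1]
  · rw [← div_eq_mul_inv, le_div_iff₀ h2]; linarith [h1.2]

lemma bumpAt_eq (τ : ℝ) {q : ℕ} (hq : 0 < q) (p : ℕ) : bumpAt τ q p =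
    fun t => (q : ℝ) ^ τ * unitBump (((q : ℝ) ^ τ * q) * (t - p / q)) := by
  have hq0 : (q : ℝ) ≠ 0 := by positivity
  funext t
  unfold bumpAt
  congr 2
  field_simp

lemma bumpAt_integrable (τ : ℝ) {q : ℕ} (hq : 0 < q) (p : ℕ) : Integrable (bumpAt τ q p) := by
  have h2 : (q : ℝ) ^ τ * q ≠ 0 := by positivity
  rw [bumpAt_eq τ hq]
  exact ((unitBump_integrable.comp_mul_left' h2).comp_sub_right ((p : ℝ) / q)).const_mul _

lemma bumpAt_integral (τ : ℝ) {q : ℕ} (hq : 0 < q) (p : ℕ) : ∫ t, bumpAt τ q p t = 1 / q := by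
  have h1 : (0 : ℝ) < (q : ℝ) ^ τ := by positivity
  have h3 : (0 : ℝ) < q := by positivity
  rw [bumpAt_eq τ hq, integral_const_mul,
    integral_sub_right_eq_self (fun t => unitBump (((q : ℝ) ^ τ * q) * t)) ((p : ℝ) / q),
    Measure.integral_comp_mul_left, unitBump_integral, abs_of_pos (by positivity)]
  simp only [smul_eq_mul]
  field_simp

lemma integrable_mul_bumpAt (τ : ℝ) {q : ℕ} (hq : 0 < q) (p : ℕ) {v : ℝ → ℝ} (hv : Measurable v)
    (hv0 : ∀ t, 0 ≤ v t) (hv1 : ∀ t, v t ≤ 1) : Integrable (fun t => v t * bumpAt τ q p t) :=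
  (bumpAt_integrable τ hq p).bdd_mul (c := 1) hv.aestronglyMeasurable
    (ae_of_all _ fun t => by rw [Real.norm_of_nonneg (hv0 t)]; exact hv1 t)

lemma integral_mul_bumpAt_nonneg (τ : ℝ) (q p : ℕ) {v : ℝ → ℝ}
    (hv0 : ∀ t, 0 ≤ v t) : 0 ≤ ∫ t, v t * bumpAt τ q p t :=
  integral_nonneg fun t => mul_nonneg (hv0 t) (bumpAt_nonneg τ q p t)

lemma integral_mul_bumpAt_le_inv (τ : ℝ) {q : ℕ} (hq : 0 < q) (p : ℕ) {v : ℝ → ℝ}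
    (hv : Measurable v) (hv0 : ∀ t, 0 ≤ v t) (hv1 : ∀ t, v t ≤ 1) :
    ∫ t, v t * bumpAt τ q p t ≤ 1 / q := by
  rw [← bumpAt_integral τ hq p]
  refine integral_mono (integrable_mul_bumpAt τ hq p hv hv0 hv1) (bumpAt_integrable τ hq p) ?_
  intro t
  exact mul_le_of_le_one_left (bumpAt_nonneg τ q p t) (hv1 t)

lemma integral_mul_bumpAt_le (τ : ℝ) {q : ℕ} (p : ℕ) {v : ℝ → ℝ}
    (hv0 : ∀ t, 0 ≤ v t) (hv1 : ∀ t, v t ≤ 1) {a b : ℝ} (hab : a ≤ b)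
    (hsupp : ∀ t, v t ≠ 0 → t ∈ Icc a b) :
    ∫ t, v t * bumpAt τ q p t ≤ 8 * (q : ℝ) ^ τ * (b - a) := by
  have h : ∫ t, v t * bumpAt τ q p t ≤ ∫ t, (Icc a b).indicator (fun _ => 8 * (q : ℝ) ^ τ) t := by
    refine integral_mono_of_nonneg ?_ ?_ ?_
    · exact ae_of_all _ fun t => mul_nonneg (hv0 t) (bumpAt_nonneg τ q p t)
    · rw [integrable_indicator_iff measurableSet_Icc]
      exact integrableOn_const (by simp)
    · refine ae_of_all _ fun t => ?_
      by_cases ht : v t = 0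
      · simp only [ht, zero_mul]
        exact indicator_nonneg (fun _ _ => by positivity) _
      · simp only [indicator_of_mem (hsupp t ht)]
        calc v t * bumpAt τ q p t ≤ 1 * (8 * (q : ℝ) ^ τ) :=
              mul_le_mul (hv1 t) (bumpAt_le τ q p t) (bumpAt_nonneg τ q p t) zero_le_one
          _ = _ := one_mul _
  refine h.trans (le_of_eq ?_)
  rw [integral_indicator_const _ measurableSet_Icc, Real.volume_real_Icc_of_le hab, smul_eq_mul]
  ring

lemma integral_mul_bumpSum (τ : ℝ) {q : ℕ} (hq : 0 < q) {v : ℝ → ℝ} (hv : Measurable v)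
    (hv0 : ∀ t, 0 ≤ v t) (hv1 : ∀ t, v t ≤ 1) :
    ∫ t, v t * bumpSum τ q t = ∑ p ∈ Finset.Ioo 0 q, ∫ t, v t * bumpAt τ q p t := by
  unfold bumpSum
  simp_rw [Finset.mul_sum]
  exact integral_finsetSum _ fun p _ => integrable_mul_bumpAt τ hq p hv hv0 hv1

lemma bumpSum_integrable (τ : ℝ) {q : ℕ} (hq : 0 < q) : Integrable (bumpSum τ q) := by
  unfold bumpSum
  exact integrable_finsetSum _ fun p _ => bumpAt_integrable τ hq p

/-- A continuous cutoff: equal to one when `q * t` is within `q ^ (-τ) / 8` of an integer, and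
vanishing when it is not within `q ^ (-τ) / 4` of an integer. -/
def nearCutoff (τ : ℝ) (q : ℕ) (t : ℝ) : ℝ :=
  max 0 (min 1 (2 - 8 * (q : ℝ) ^ τ * ‖((q * t : ℝ) : UnitAddCircle)‖))

lemma nearCutoff_continuous (τ : ℝ) (q : ℕ) : Continuous (nearCutoff τ q) := by
  unfold nearCutoff
  have : Continuous fun t : ℝ => ((q * t : ℝ) : UnitAddCircle) :=
    (AddCircle.continuous_mk' 1).comp (by fun_prop)
  fun_prop

lemma nearCutoff_nonneg (τ : ℝ) (q : ℕ) (t : ℝ) : 0 ≤ nearCutoff τ q t := le_max_left _ _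

lemma nearCutoff_le_one (τ : ℝ) (q : ℕ) (t : ℝ) : nearCutoff τ q t ≤ 1 :=
  max_le zero_le_one (min_le_left _ _)

lemma nearCutoff_eq_one {τ : ℝ} {q : ℕ} (hq : 0 < q) {t : ℝ} {p : ℤ}
    (h : |(q : ℝ) * t - p| ≤ 1 / 8 * (q : ℝ) ^ (-τ)) : nearCutoff τ q t = 1 := by
  have hq0 : (0 : ℝ) < q := by exact_mod_cast hq
  have h2 : (0 : ℝ) < (q : ℝ) ^ τ := by positivity
  have h1 : ‖((q * t : ℝ) : UnitAddCircle)‖ ≤ 1 / 8 * (q : ℝ) ^ (-τ) := by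
    rw [UnitAddCircle.norm_eq]
    exact (round_le _ _).trans h
  have h3 : 8 * (q : ℝ) ^ τ * ‖((q * t : ℝ) : UnitAddCircle)‖ ≤ 1 := by
    calc _ ≤ 8 * (q : ℝ) ^ τ * (1 / 8 * (q : ℝ) ^ (-τ)) := by gcongr
      _ = 1 := by rw [Real.rpow_neg hq0.le]; field_simp
  unfold nearCutoff
  rw [min_eq_left (by linarith), max_eq_right zero_le_one]

lemma exists_of_nearCutoff_ne_zero {τ : ℝ} {q : ℕ} (hq : 0 < q) {t : ℝ}
    (h : nearCutoff τ q t ≠ 0) : ∃ p : ℤ, |(q : ℝ) * t - p| < 1 / 4 * (q : ℝ) ^ (-τ) := by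
  have hq0 : (0 : ℝ) < q := by exact_mod_cast hq
  have h2 : (0 : ℝ) < (q : ℝ) ^ τ := by positivity
  refine ⟨round ((q : ℝ) * t), ?_⟩
  rw [← UnitAddCircle.norm_eq]
  by_contra! hc
  apply h
  have h3 : 2 ≤ 8 * (q : ℝ) ^ τ * ‖((q * t : ℝ) : UnitAddCircle)‖ := by
    calc (2 : ℝ) = 8 * (q : ℝ) ^ τ * (1 / 4 * (q : ℝ) ^ (-τ)) := by
          rw [Real.rpow_neg hq0.le]; field_simp; norm_num
      _ ≤ _ := by gcongr
  unfold nearCutoff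
  exact max_eq_left ((min_le_right _ _).trans (by linarith))

/-- A continuous cutoff to the interval `|R * t - a| ≤ 1`. -/
def gridCutoff (R : ℝ) (a : ℤ) (t : ℝ) : ℝ := max 0 (min 1 (2 - |R * t - a|))

lemma gridCutoff_continuous (R : ℝ) (a : ℤ) : Continuous (gridCutoff R a) := by
  unfold gridCutoff
  fun_prop

lemma gridCutoff_nonneg (R : ℝ) (a : ℤ) (t : ℝ) : 0 ≤ gridCutoff R a t := le_max_left _ _

lemma gridCutoff_le_one (R : ℝ) (a : ℤ) (t : ℝ) : gridCutoff R a t ≤ 1 :=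
  max_le zero_le_one (min_le_left _ _)

lemma gridCutoff_eq_one {R : ℝ} {a : ℤ} {t : ℝ} (h : |R * t - a| ≤ 1) : gridCutoff R a t = 1 := by
  unfold gridCutoff
  rw [min_eq_left (by linarith), max_eq_right zero_le_one]

lemma abs_lt_of_gridCutoff_ne_zero {R : ℝ} {a : ℤ} {t : ℝ} (h : gridCutoff R a t ≠ 0) :
    |R * t - a| < 2 := by
  by_contra! hc
  exact h (max_eq_left ((min_le_right _ _).trans (by linarith)))

lemma sum_gridCutoff_le (R : ℝ) (A : Finset ℤ) (t : ℝ) : ∑ a ∈ A, gridCutoff R a t ≤ 4 := by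
  classical
  have h1 : ∑ a ∈ A, gridCutoff R a t ≤ ∑ a ∈ A with a ∈ Finset.Icc (⌊R * t⌋ - 1) (⌊R * t⌋ + 2),
      (1 : ℝ) := by
    rw [Finset.sum_filter]
    refine Finset.sum_le_sum fun a _ => ?_
    split_ifs with h
    · exact gridCutoff_le_one R a t
    · refine le_of_eq ?_
      by_contra hne
      apply h
      have h2 := abs_lt.1 (abs_lt_of_gridCutoff_ne_zero hne)
      have h3 := Int.floor_le (R * t)
      have h4 := Int.lt_floor_add_one (R * t)
      rw [Finset.mem_Icc]
      constructor
      · have : (⌊R * t⌋ : ℝ) < ((a + 2 : ℤ) : ℝ) := by push_cast; linarith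
        have := Int.cast_lt.1 this
        omega
      · have : (a : ℝ) < ((⌊R * t⌋ + 3 : ℤ) : ℝ) := by push_cast; linarith
        have := Int.cast_lt.1 this
        omega
  refine h1.trans ?_
  rw [Finset.sum_const, nsmul_eq_mul, mul_one]
  have h5 : (A.filter (fun a => a ∈ Finset.Icc (⌊R * t⌋ - 1) (⌊R * t⌋ + 2))).card ≤
      (Finset.Icc (⌊R * t⌋ - 1) (⌊R * t⌋ + 2)).card :=
    Finset.card_le_card fun a ha => (Finset.mem_filter.1 ha).2
  rw [Int.card_Icc] at h5
  have h6 : (⌊R * t⌋ + 2 + 1 - (⌊R * t⌋ - 1)).toNat = 4 := by omega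
  rw [h6] at h5
  exact_mod_cast h5

lemma exists_ne_zero_of_integral_mul_ne_zero {v w : ℝ → ℝ} (h : ∫ t, v t * w t ≠ 0) :
    ∃ t, v t ≠ 0 ∧ w t ≠ 0 := by
  by_contra! hc
  apply h
  have : (fun t => v t * w t) = fun _ => 0 := by
    funext t
    by_cases hv : v t = 0
    · rw [hv, zero_mul]
    · rw [hc t hv, mul_zero]
  rw [this, integral_zero]

lemma sum_le_card_filter_mul {ι : Type*} (s : Finset ι) (f : ι → ℝ) [DecidablePred fun i => f i ≠ 0]
    {B : ℝ} (hB : ∀ i ∈ s, f i ≤ B) :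
    ∑ i ∈ s, f i ≤ ((s.filter fun i => f i ≠ 0).card : ℝ) * B := by
  rw [← Finset.sum_filter_ne_zero, ← nsmul_eq_mul]
  exact Finset.sum_le_card_nsmul _ _ _ fun i hi => hB i (Finset.mem_filter.1 hi).1

lemma rpow_neg_le_one_of_pos {q : ℕ} (hq : 0 < q) {τ : ℝ} (hτ : 0 ≤ τ) : (q : ℝ) ^ (-τ) ≤ 1 :=
  Real.rpow_le_one_of_one_le_of_nonpos (by exact_mod_cast hq) (by linarith)

lemma rpow_mul_rpow_neg_self {q : ℕ} (hq : 0 < q) (τ : ℝ) : (q : ℝ) ^ τ * (q : ℝ) ^ (-τ) = 1 := by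
  have hq0 : (0 : ℝ) < q := by exact_mod_cast hq
  rw [← Real.rpow_add hq0, add_neg_cancel, Real.rpow_zero]

/-- The bumps with prime denominator `q` give little mass to the neighbourhoods of the fractions
with denominator `q'`. -/
lemma integral_nearCutoff_mul_bumpSum_le {τ : ℝ} (hτ : 0 ≤ τ) {q q' : ℕ} (hq : q.Prime)
    (hq' : 0 < q') :
    ∫ t, nearCutoff τ q' t * bumpSum τ q t ≤ 5 * (q' : ℝ) ^ (-τ) := by
  classical
  have hq0 : (0 : ℝ) < q := by exact_mod_cast hq.pos
  have hq0' : (0 : ℝ) < q' := by exact_mod_cast hq'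
  set A : ℝ := (q : ℝ) ^ (-τ) with hA
  set A' : ℝ := (q' : ℝ) ^ (-τ) with hA'
  have hA0 : 0 < A := by positivity
  have hA0' : 0 < A' := by positivity
  have hA1 : A ≤ 1 := rpow_neg_le_one_of_pos hq.pos hτ
  have hA1' : A' ≤ 1 := rpow_neg_le_one_of_pos hq' hτ
  have hqA : (q : ℝ) ^ τ * A = 1 := rpow_mul_rpow_neg_self hq.pos τ
  let V : ℤ → ℝ → ℝ := fun p' => {t : ℝ | |(q' : ℝ) * t - p'| < 1 / 4 * A'}.indicator fun _ => 1
  have hVm : ∀ p', Measurable (V p') := fun p' =>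
    measurable_const.indicator (measurableSet_lt (by fun_prop) measurable_const)
  have hV0 : ∀ p' t, 0 ≤ V p' t := fun p' t => indicator_nonneg (fun _ _ => zero_le_one) _
  have hV1 : ∀ p' t, V p' t ≤ 1 := fun p' t => indicator_le_self' (fun _ _ => zero_le_one) _
  have hVmem : ∀ p' t, V p' t ≠ 0 → |(q' : ℝ) * t - p'| < 1 / 4 * A' := fun p' t h =>
    mem_of_indicator_ne_zero (s := {t : ℝ | |(q' : ℝ) * t - p'| < 1 / 4 * A'}) h
  set P' : Finset ℤ := Finset.Icc (-1) (q' + 1) with hP'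
  have hpoint : ∀ p ∈ Finset.Ioo 0 q, ∫ t, nearCutoff τ q' t * bumpAt τ q p t ≤
      ∑ p' ∈ P', ∫ t, V p' t * bumpAt τ q p t := by
    intro p hp
    rw [Finset.mem_Ioo] at hp
    rw [← integral_finsetSum _ fun p' _ =>
      integrable_mul_bumpAt τ hq.pos p (hVm p') (hV0 p') (hV1 p')]
    refine integral_mono (integrable_mul_bumpAt τ hq.pos p (nearCutoff_continuous τ q').measurable
      (nearCutoff_nonneg τ q') (nearCutoff_le_one τ q')) (integrable_finsetSum _ fun p' _ =>
      integrable_mul_bumpAt τ hq.pos p (hVm p') (hV0 p') (hV1 p')) ?_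
    intro t
    simp only
    have hn : ∀ p' ∈ P', 0 ≤ V p' t * bumpAt τ q p t := fun p' _ =>
      mul_nonneg (hV0 p' t) (bumpAt_nonneg τ q p t)
    by_cases hb : bumpAt τ q p t = 0
    · simp [hb]
    by_cases hc : nearCutoff τ q' t = 0
    · simp only [hc, zero_mul]; exact Finset.sum_nonneg hn
    obtain ⟨p', hp'⟩ := exists_of_nearCutoff_ne_zero hq' hc
    have hbt := mem_of_bumpAt_ne_zero hq.pos hb
    have ht0 : 0 < t := by
      have : 0 < (q : ℝ) * t := by
        have : (0 : ℝ) < p := by exact_mod_cast hp.1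
        linarith [hbt.1]
      exact (mul_pos_iff_of_pos_left hq0).1 this
    have ht1 : t < 1 := by
      have h1 : (p : ℝ) + 1 ≤ q := by exact_mod_cast hp.2
      have : (q : ℝ) * t < q * 1 := by linarith [hbt.2]
      exact lt_of_mul_lt_mul_left this hq0.le
    have h2 : (q' : ℝ) * t < q' := by nlinarith
    have h3 : 0 < (q' : ℝ) * t := by positivity
    have hmem : p' ∈ P' := by
      rw [abs_lt] at hp'
      rw [hP', Finset.mem_Icc]
      constructor
      · have : ((-1 : ℤ) : ℝ) < p' := by push_cast; linarith
        exact (Int.cast_lt.1 this).le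
      · have : (p' : ℝ) < ((q' + 1 : ℤ) : ℝ) := by push_cast; linarith
        exact (Int.cast_lt.1 this).le
    refine le_trans ?_ (Finset.single_le_sum hn hmem)
    have : V p' t = 1 := indicator_of_mem (s := {t : ℝ | |(q' : ℝ) * t - p'| < 1 / 4 * A'}) hp' _
    rw [this]
    exact mul_le_mul_of_nonneg_right (nearCutoff_le_one τ q' t) (bumpAt_nonneg τ q p t)
  rw [integral_mul_bumpSum τ hq.pos (nearCutoff_continuous τ q').measurable
      (nearCutoff_nonneg τ q') (nearCutoff_le_one τ q')]
  refine (Finset.sum_le_sum hpoint).trans ?_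
  rw [← Finset.sum_product']
  set B : ℝ := min (1 / (q : ℝ)) (8 * (q : ℝ) ^ τ * (1 / 2 * A' / q')) with hB
  have hB0 : 0 ≤ B := le_min (by positivity) (by positivity)
  have hbound : ∀ z ∈ Finset.Ioo 0 q ×ˢ P', ∫ t, V z.2 t * bumpAt τ q z.1 t ≤ B := by
    intro z _
    refine le_min (integral_mul_bumpAt_le_inv τ hq.pos z.1 (hVm _) (hV0 _) (hV1 _)) ?_
    have := integral_mul_bumpAt_le τ (q := q) z.1 (hV0 z.2) (hV1 z.2)
      (a := (z.2 - 1 / 4 * A') / q') (b := (z.2 + 1 / 4 * A') / q') (by gcongr; linarith) ?_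
    · refine this.trans (le_of_eq ?_)
      ring
    · intro t ht
      have := abs_lt.1 (hVmem _ _ ht)
      constructor
      · rw [div_le_iff₀ hq0']; linarith
      · rw [le_div_iff₀ hq0']; linarith
  refine (sum_le_card_filter_mul _ _ hbound).trans ?_
  set L : ℝ := q' * (1 / 2 * A) + q * (1 / 4 * A') with hL
  have hcard := card_close_pairs_le hq q' (L := L) (by positivity)
    ((Finset.Ioo 0 q ×ˢ P').filter fun z => ∫ t, V z.2 t * bumpAt τ q z.1 t ≠ 0) ?_
  · calc _ ≤ 2 * L * B := mul_le_mul_of_nonneg_right hcard hB0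
      _ = q' * A * B + 1 / 2 * q * A' * B := by rw [hL]; ring
      _ ≤ q' * A * (8 * (q : ℝ) ^ τ * (1 / 2 * A' / q')) + 1 / 2 * q * A' * (1 / q) := by
          gcongr
          · exact min_le_right _ _
          · exact min_le_left _ _
      _ = 4 * A' * ((q : ℝ) ^ τ * A) + 1 / 2 * A' := by field_simp; ring
      _ ≤ 5 * A' := by rw [hqA]; linarith
  · intro z hz
    rw [Finset.mem_filter, Finset.mem_product, Finset.mem_Ioo] at hz
    obtain ⟨⟨⟨hz1, hz2⟩, -⟩, hz3⟩ := hz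
    obtain ⟨t, hV, hb⟩ := exists_ne_zero_of_integral_mul_ne_zero hz3
    have hy := abs_lt.1 (hVmem _ _ hV)
    have hx := mem_of_bumpAt_ne_zero hq.pos hb
    rw [← hA] at hx
    have hk : (((q : ℤ) * z.2 - q' * z.1 : ℤ) : ℝ) =
        q' * ((q : ℝ) * t - z.1) - q * ((q' : ℝ) * t - z.2) := by push_cast; ring
    refine ⟨hz1, hz2, ?_, ?_⟩
    · intro h0
      have hdvd : (q : ℤ) ∣ q' * z.1 := ⟨z.2, by linarith⟩
      have hdvd' : q ∣ q' * z.1 := by exact_mod_cast hdvd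
      have hqq : q ∣ q' := by
        rcases hq.dvd_mul.1 hdvd' with h | h
        · exact h
        · exact absurd (Nat.le_of_dvd hz1 h) (by omega)
      have hle : (q : ℝ) ≤ q' := by exact_mod_cast Nat.le_of_dvd hq' hqq
      have hAA : A' ≤ A := Real.rpow_le_rpow_of_nonpos hq0 hle (by linarith)
      rw [h0, Int.cast_zero] at hk
      have h1 : (q' : ℝ) * (1 / 4 * A) ≤ q' * ((q : ℝ) * t - z.1) := by gcongr; exact hx.1
      have h2 : (q : ℝ) * ((q' : ℝ) * t - z.2) < q * (1 / 4 * A') := by gcongr; exact hy.2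
      have h3 : (q : ℝ) * (1 / 4 * A') ≤ q' * (1 / 4 * A) := by gcongr
      linarith
    · rw [hk]
      refine (abs_sub _ _).trans ?_
      rw [abs_mul, abs_mul, abs_of_pos hq0, abs_of_pos hq0', hL]
      have : |(q : ℝ) * t - z.1| ≤ 1 / 2 * A := by
        rw [abs_of_nonneg (by linarith [hx.1])]; exact hx.2
      gcongr
      exact (abs_lt.2 hy).le

lemma integral_gridCutoff_mul_bumpAt_le (τ : ℝ) {q : ℕ} (hq : 0 < q) (p : ℕ) {R : ℝ} (hR : 0 < R)
    (a : ℤ) : ∫ t, gridCutoff R a t * bumpAt τ q p t ≤ min (1 / (q : ℝ)) (32 * (q : ℝ) ^ τ / R) := by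
  refine le_min (integral_mul_bumpAt_le_inv τ hq p (gridCutoff_continuous R a).measurable
    (gridCutoff_nonneg R a) (gridCutoff_le_one R a)) ?_
  have := integral_mul_bumpAt_le τ (q := q) p (gridCutoff_nonneg R a) (gridCutoff_le_one R a)
      (a := (a - 2) / R) (b := (a + 2) / R) (by gcongr; linarith) ?_
  · refine this.trans (le_of_eq ?_)
    field_simp
    norm_num
  · intro t ht
    have := abs_lt.1 (abs_lt_of_gridCutoff_ne_zero ht)
    constructor
    · rw [div_le_iff₀ hR]; linarith
    · rw [le_div_iff₀ hR]; linarith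

lemma sum_integral_gridCutoff_mul_bumpAt_le (τ : ℝ) {q : ℕ} (hq : 0 < q) (p : ℕ) (R : ℝ)
    (A : Finset ℤ) : ∑ a ∈ A, ∫ t, gridCutoff R a t * bumpAt τ q p t ≤ 4 / q := by
  have hi : ∀ a ∈ A, Integrable fun t => gridCutoff R a t * bumpAt τ q p t := fun a _ =>
    integrable_mul_bumpAt τ hq p (gridCutoff_continuous R a).measurable (gridCutoff_nonneg R a)
      (gridCutoff_le_one R a)
  rw [← integral_finsetSum _ hi]
  calc _ ≤ ∫ t, 4 * bumpAt τ q p t := by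
        refine integral_mono (integrable_finsetSum _ hi) ((bumpAt_integrable τ hq p).const_mul 4) ?_
        intro t
        simp only
        rw [← Finset.sum_mul]
        exact mul_le_mul_of_nonneg_right (sum_gridCutoff_le R A t) (bumpAt_nonneg τ q p t)
    _ = 4 / q := by rw [integral_const_mul, bumpAt_integral τ hq, mul_one_div]

/-- Bumps with distinct prime denominators are independent at every scale, up to a constant. -/
lemma sum_gridCutoff_mul_le_of_lt {τ : ℝ} (hτ : 0 ≤ τ) {q q' : ℕ} (hq : q.Prime) (hq' : q'.Prime)
    (hlt : q < q') {R : ℝ} (hR : 0 < R) (A : Finset ℤ) :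
    ∑ a ∈ A, (∫ t, gridCutoff R a t * bumpSum τ q t) * (∫ t, gridCutoff R a t * bumpSum τ q' t) ≤
      160 / R := by
  classical
  have hq0 : (0 : ℝ) < q := by exact_mod_cast hq.pos
  have hq0' : (0 : ℝ) < q' := by exact_mod_cast hq'.pos
  set I : ℕ → ℕ → ℤ → ℝ := fun n p a => ∫ t, gridCutoff R a t * bumpAt τ n p t with hI
  have hI0 : ∀ n p a, 0 ≤ I n p a := fun n p a =>
    integral_mul_bumpAt_nonneg τ n p (gridCutoff_nonneg R a)
  set B : ℝ := min (1 / (q : ℝ)) (32 * (q : ℝ) ^ τ / R) with hB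
  have hB0 : 0 ≤ B := le_min (by positivity) (by positivity)
  have e : ∑ a ∈ A, (∫ t, gridCutoff R a t * bumpSum τ q t) *
      (∫ t, gridCutoff R a t * bumpSum τ q' t) =
      ∑ z ∈ Finset.Ioo 0 q ×ˢ Finset.Ioo 0 q', ∑ a ∈ A, I q z.1 a * I q' z.2 a := by
    rw [Finset.sum_comm]
    refine Finset.sum_congr rfl fun a _ => ?_
    rw [integral_mul_bumpSum τ hq.pos (gridCutoff_continuous R a).measurable (gridCutoff_nonneg R a)
      (gridCutoff_le_one R a), integral_mul_bumpSum τ hq'.pos (gridCutoff_continuous R a).measurable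
      (gridCutoff_nonneg R a) (gridCutoff_le_one R a), Finset.sum_mul_sum, Finset.sum_product]
  rw [e]
  have hbound : ∀ z ∈ Finset.Ioo 0 q ×ˢ Finset.Ioo 0 q', ∑ a ∈ A, I q z.1 a * I q' z.2 a ≤
      B * (4 / q') := by
    intro z _
    calc ∑ a ∈ A, I q z.1 a * I q' z.2 a ≤ ∑ a ∈ A, B * I q' z.2 a :=
          Finset.sum_le_sum fun a _ => mul_le_mul_of_nonneg_right
            (integral_gridCutoff_mul_bumpAt_le τ hq.pos z.1 hR a) (hI0 _ _ _)
      _ = B * ∑ a ∈ A, I q' z.2 a := by rw [Finset.mul_sum]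
      _ ≤ _ := mul_le_mul_of_nonneg_left
            (sum_integral_gridCutoff_mul_bumpAt_le τ hq'.pos z.2 R A) hB0
  refine (sum_le_card_filter_mul _ _ hbound).trans ?_
  set W : ℝ := (q : ℝ) ^ (-τ) with hW
  have hW0 : 0 < W := by positivity
  have hqW : (q : ℝ) ^ τ * W = 1 := rpow_mul_rpow_neg_self hq.pos τ
  set L : ℝ := q * q' * (4 / R) + q' * (1 / 2 * W) with hL
  set S := (Finset.Ioo 0 q ×ˢ Finset.Ioo 0 q').filter
    fun z => ∑ a ∈ A, I q z.1 a * I q' z.2 a ≠ 0 with hS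
  have hinj : Function.Injective (fun z : ℕ × ℕ => ((z.1, (z.2 : ℤ)) : ℕ × ℤ)) := by
    intro z w h
    simp only [Prod.mk.injEq, Nat.cast_inj] at h
    exact Prod.ext h.1 h.2
  have hcard := card_close_pairs_le hq q' (L := L) (by positivity)
    (S.image fun z : ℕ × ℕ => ((z.1, (z.2 : ℤ)) : ℕ × ℤ)) ?_
  · rw [Finset.card_image_of_injective _ hinj] at hcard
    calc _ ≤ 2 * L * (B * (4 / q')) := mul_le_mul_of_nonneg_right hcard (by positivity)
      _ = 32 / R * (q * B) + 4 * W * B := by rw [hL]; field_simp; ring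
      _ ≤ 32 / R * (q * (1 / q)) + 4 * W * (32 * (q : ℝ) ^ τ / R) := by
          gcongr
          · exact min_le_left _ _
          · exact min_le_right _ _
      _ = 32 / R + 128 / R * ((q : ℝ) ^ τ * W) := by field_simp; ring
      _ = 160 / R := by rw [hqW]; ring
  · intro y hy
    rw [Finset.mem_image] at hy
    obtain ⟨z, hz, rfl⟩ := hy
    rw [hS, Finset.mem_filter, Finset.mem_product, Finset.mem_Ioo, Finset.mem_Ioo] at hz
    obtain ⟨⟨⟨hz1, hz2⟩, hz3, hz4⟩, hz5⟩ := hz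
    simp only
    refine ⟨hz1, hz2, ?_, ?_⟩
    · intro h0
      have h1 : (q : ℤ) * z.2 = q' * z.1 := by linarith
      have h2 : q * z.2 = q' * z.1 := by exact_mod_cast h1
      have h3 : q ∣ q' * z.1 := ⟨z.2, h2.symm⟩
      rcases hq.dvd_mul.1 h3 with h | h
      · exact hlt.ne ((Nat.prime_dvd_prime_iff_eq hq hq').1 h)
      · exact absurd (Nat.le_of_dvd hz1 h) (by omega)
    · obtain ⟨a, -, ha⟩ := Finset.exists_ne_zero_of_sum_ne_zero hz5
      obtain ⟨t, ht, hb⟩ := exists_ne_zero_of_integral_mul_ne_zero (left_ne_zero_of_mul ha)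
      obtain ⟨t', ht', hb'⟩ := exists_ne_zero_of_integral_mul_ne_zero (right_ne_zero_of_mul ha)
      have h1 := abs_lt.1 (abs_lt_of_gridCutoff_ne_zero ht)
      have h2 := abs_lt.1 (abs_lt_of_gridCutoff_ne_zero ht')
      have hx := mem_of_bumpAt_ne_zero hq.pos hb
      have hx' := mem_of_bumpAt_ne_zero hq'.pos hb'
      rw [← hW] at hx
      have hWW : (q' : ℝ) ^ (-τ) ≤ W :=
        Real.rpow_le_rpow_of_nonpos hq0 (by exact_mod_cast hlt.le) (by linarith)
      have hW0' : 0 < (q' : ℝ) ^ (-τ) := by positivity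
      have h3 : |t' - t| ≤ 4 / R := by
        rw [le_div_iff₀ hR]
        calc |t' - t| * R = |(t' - t) * R| := by rw [abs_mul, abs_of_pos hR]
          _ ≤ 4 := by rw [abs_le]; constructor <;> nlinarith
      set x := (q : ℝ) * t - z.1
      set x' := (q' : ℝ) * t' - z.2
      have hk : (((q : ℤ) * (z.2 : ℤ) - q' * z.1 : ℤ) : ℝ) =
        q * q' * (t' - t) + (q' * x - q * x') := by simp only [x, x']; push_cast; ring
      rw [hk]
      refine (abs_add_le _ _).trans ?_
      rw [hL]
      refine add_le_add ?_ ?_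
      · rw [abs_mul, abs_of_pos (by positivity)]
        gcongr
      · have hle : (q : ℝ) ≤ q' := by exact_mod_cast hlt.le
        have hxu : q' * x ≤ q' * (1 / 2 * W) := by gcongr; exact hx.2
        have hxl : 0 ≤ q' * x := mul_nonneg hq0'.le (by linarith [hx.1])
        have hxu' : q * x' ≤ q' * (1 / 2 * W) := by
          apply mul_le_mul hle (by linarith [hx'.2]) (by linarith [hx'.1]) hq0'.le
        have hxl' : 0 ≤ q * x' := mul_nonneg hq0.le (by linarith [hx'.1])
        rw [abs_le]
        constructor <;> linarith

lemma sum_gridCutoff_mul_le_of_ne {τ : ℝ} (hτ : 0 ≤ τ) {q q' : ℕ} (hq : q.Prime) (hq' : q'.Prime)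
    (hne : q ≠ q') {R : ℝ} (hR : 0 < R) (A : Finset ℤ) :
    ∑ a ∈ A, (∫ t, gridCutoff R a t * bumpSum τ q t) * (∫ t, gridCutoff R a t * bumpSum τ q' t) ≤
      160 / R := by
  rcases lt_or_gt_of_ne hne with h | h
  · exact sum_gridCutoff_mul_le_of_lt hτ hq hq' h hR A
  · simp_rw [mul_comm (∫ t, gridCutoff R _ t * bumpSum τ q t)]
    exact sum_gridCutoff_mul_le_of_lt hτ hq' hq h hR A

lemma integral_gridCutoff_mul_bumpSum_le {τ : ℝ} (hτ : 0 ≤ τ) {q : ℕ} (hq : 0 < q) {R : ℝ}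
    (hR : 0 < R) (a : ℤ) : ∫ t, gridCutoff R a t * bumpSum τ q t ≤
      (4 * q / R + 2) * min (1 / (q : ℝ)) (32 * (q : ℝ) ^ τ / R) := by
  classical
  have hq0 : (0 : ℝ) < q := by exact_mod_cast hq
  rw [integral_mul_bumpSum τ hq (gridCutoff_continuous R a).measurable (gridCutoff_nonneg R a)
      (gridCutoff_le_one R a)]
  refine (sum_le_card_filter_mul _ _ fun p _ =>
    integral_gridCutoff_mul_bumpAt_le τ hq p hR a).trans ?_
  refine mul_le_mul_of_nonneg_right ?_ (le_min (by positivity) (by positivity))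
  set S := (Finset.Ioo 0 q).filter fun p => ∫ t, gridCutoff R a t * bumpAt τ q p t ≠ 0 with hS
  set c : ℝ := q * a / R with hc
  set d : ℝ := 2 * q / R with hd
  have hd0 : 0 < d := by positivity
  have hsub : S.image (fun p : ℕ => (p : ℤ)) ⊆ Finset.Icc ⌈c - d - 1 / 2⌉ ⌊c + d⌋ := by
    intro y hy
    rw [Finset.mem_image] at hy
    obtain ⟨p, hp, rfl⟩ := hy
    obtain ⟨t, ht, hb⟩ := exists_ne_zero_of_integral_mul_ne_zero (Finset.mem_filter.1 hp).2
    have h1 := abs_lt.1 (abs_lt_of_gridCutoff_ne_zero ht)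
    have hx := mem_of_bumpAt_ne_zero hq hb
    have hW := rpow_neg_le_one_of_pos hq hτ
    have hW0 : 0 < (q : ℝ) ^ (-τ) := by positivity
    have h2 : q * t ≤ c + d := by
      rw [hc, hd, ← add_div, le_div_iff₀ hR]; nlinarith
    have h3 : c - d ≤ q * t := by
      rw [hc, hd, ← sub_div, div_le_iff₀ hR]; nlinarith
    rw [Finset.mem_Icc]
    refine ⟨Int.ceil_le.2 ?_, Int.le_floor.2 ?_⟩
    · push_cast; linarith [hx.2]
    · push_cast; linarith [hx.1]
  have hcard := Finset.card_le_card hsub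
  rw [Finset.card_image_of_injective _ Nat.cast_injective, Int.card_Icc] at hcard
  have h1 : (S.card : ℝ) ≤ (((⌊c + d⌋ + 1 - ⌈c - d - 1 / 2⌉).toNat : ℕ) : ℝ) := by exact_mod_cast hcard
  refine h1.trans ?_
  have h2 : (((⌊c + d⌋ + 1 - ⌈c - d - 1 / 2⌉).toNat : ℕ) : ℝ) =
      ((max (⌊c + d⌋ + 1 - ⌈c - d - 1 / 2⌉) 0 : ℤ) : ℝ) := by
    rw [← Int.toNat_eq_max]; norm_cast
  have h3 : 4 * (q : ℝ) / R = 2 * d := by rw [hd]; ring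
  rw [h2, h3, Int.cast_max]
  refine max_le ?_ (by push_cast; linarith)
  push_cast
  linarith [Int.floor_le (c + d), Int.le_ceil (c - d - 1 / 2)]

lemma sum_sq_gridCutoff_le {τ : ℝ} (hτ : 0 ≤ τ) {q : ℕ} (hq : 0 < q) {R : ℝ}
    (hR : 0 < R) (A : Finset ℤ) :
    ∑ a ∈ A, (∫ t, gridCutoff R a t * bumpSum τ q t) * (∫ t, gridCutoff R a t * bumpSum τ q t) ≤
      4 * ((4 * q / R + 2) * min (1 / (q : ℝ)) (32 * (q : ℝ) ^ τ / R)) := by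
  have hq0 : (0 : ℝ) < q := by exact_mod_cast hq
  set B := (4 * q / R + 2) * min (1 / (q : ℝ)) (32 * (q : ℝ) ^ τ / R) with hB
  have hB0 : 0 ≤ B := mul_nonneg (by positivity) (le_min (by positivity) (by positivity))
  have h0 : ∀ a, 0 ≤ ∫ t, gridCutoff R a t * bumpSum τ q t := fun a =>
    integral_nonneg fun t => mul_nonneg (gridCutoff_nonneg R a t) (bumpSum_nonneg τ q t)
  have hs : ∑ a ∈ A, ∫ t, gridCutoff R a t * bumpSum τ q t ≤ 4 := by
    have : ∀ a ∈ A, ∫ t, gridCutoff R a t * bumpSum τ q t =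
        ∑ p ∈ Finset.Ioo 0 q, ∫ t, gridCutoff R a t * bumpAt τ q p t := fun a _ =>
      integral_mul_bumpSum τ hq (gridCutoff_continuous R a).measurable (gridCutoff_nonneg R a)
        (gridCutoff_le_one R a)
    rw [Finset.sum_congr rfl this, Finset.sum_comm]
    refine (Finset.sum_le_sum fun p _ =>
      sum_integral_gridCutoff_mul_bumpAt_le τ hq p R A).trans ?_
    rw [Finset.sum_const, Nat.card_Ioo, nsmul_eq_mul]
    have : ((q - 0 - 1 : ℕ) : ℝ) ≤ q := by exact_mod_cast (by omega : q - 0 - 1 ≤ q)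
    calc ((q - 0 - 1 : ℕ) : ℝ) * (4 / q) ≤ q * (4 / q) := by gcongr
      _ = 4 := by field_simp
  calc _ ≤ ∑ a ∈ A, (∫ t, gridCutoff R a t * bumpSum τ q t) * B :=
        Finset.sum_le_sum fun a _ => mul_le_mul_of_nonneg_left
          (integral_gridCutoff_mul_bumpSum_le hτ hq hR a) (h0 a)
    _ = (∑ a ∈ A, ∫ t, gridCutoff R a t * bumpSum τ q t) * B := by rw [Finset.sum_mul]
    _ ≤ 4 * B := mul_le_mul_of_nonneg_right hs hB0

/-- The average over `q ∈ S` of the product bumps concentrated near the rational points with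
denominator `q`. -/
def ratDensity (τ : Fin 2 → ℝ) (S : Finset ℕ) (x : Fin 2 → ℝ) : ℝ :=
  (S.card : ℝ)⁻¹ * ∑ q ∈ S, ∏ i, bumpSum (τ i) q (x i)

lemma ratDensity_continuous (τ : Fin 2 → ℝ) (S : Finset ℕ) : Continuous (ratDensity τ S) := by
  unfold ratDensity
  refine continuous_const.mul (continuous_finsetSum _ fun q _ => continuous_finsetProd _ fun i _ =>
    (bumpSum_continuous _ _).comp (continuous_apply i))

lemma ratDensity_nonneg (τ : Fin 2 → ℝ) (S : Finset ℕ) (x : Fin 2 → ℝ) : 0 ≤ ratDensity τ S x :=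
  mul_nonneg (by positivity) (Finset.sum_nonneg fun _ _ => Finset.prod_nonneg fun _ _ =>
    bumpSum_nonneg _ _ _)

lemma integrable_mul_bumpSum (τ : ℝ) {q : ℕ} (hq : 0 < q) {v : ℝ → ℝ} (hv : Continuous v)
    (hv0 : ∀ t, 0 ≤ v t) (hv1 : ∀ t, v t ≤ 1) : Integrable (fun t => v t * bumpSum τ q t) :=
  (bumpSum_integrable τ hq).bdd_mul (c := 1) hv.aestronglyMeasurable
    (ae_of_all _ fun t => by rw [Real.norm_of_nonneg (hv0 t)]; exact hv1 t)

lemma integral_prod_mul_ratDensity_le (τ : Fin 2 → ℝ) {S : Finset ℕ} (hS : ∀ q ∈ S, 0 < q)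
    {v : Fin 2 → ℝ → ℝ} (hv : ∀ i, Continuous (v i)) (hv0 : ∀ i t, 0 ≤ v i t)
    (hv1 : ∀ i t, v i t ≤ 1) {f : (Fin 2 → ℝ) → ℝ} (hf0 : ∀ x, 0 ≤ f x) {D : ℝ}
    (hfD : ∀ x, f x ≤ D) :
    ∫ x, (∏ i, v i (x i)) * (f x * ratDensity τ S x) ≤
      D * ((S.card : ℝ)⁻¹ * ∑ q ∈ S, ∏ i, ∫ t, v i t * bumpSum (τ i) q t) := by
  have hint : ∀ q ∈ S, Integrable fun x : Fin 2 → ℝ => ∏ i, (v i (x i) * bumpSum (τ i) q (x i)) :=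
    fun q hq => Integrable.fintype_prod (f := fun i t => v i t * bumpSum (τ i) q t)
      fun i => integrable_mul_bumpSum (τ i) (hS q hq) (hv i) (hv0 i) (hv1 i)
  have h : ∀ q ∈ S, ∏ i, ∫ t, v i t * bumpSum (τ i) q t =
      ∫ x : Fin 2 → ℝ, ∏ i, (v i (x i) * bumpSum (τ i) q (x i)) := fun q _ =>
    (integral_fintype_prod_volume_eq_prod fun i t => v i t * bumpSum (τ i) q t).symm
  rw [Finset.sum_congr rfl h, ← integral_finsetSum _ hint, ← integral_const_mul,
    ← integral_const_mul]
  refine integral_mono_of_nonneg ?_ ?_ ?_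
  · exact ae_of_all _ fun x => mul_nonneg (Finset.prod_nonneg fun i _ => hv0 i _)
      (mul_nonneg (hf0 x) (ratDensity_nonneg τ S x))
  · exact ((integrable_finsetSum _ hint).const_mul _).const_mul _
  · refine ae_of_all _ fun x => ?_
    simp only [Finset.prod_mul_distrib, ← Finset.mul_sum]
    have : (∏ i, v i (x i)) * (f x * ratDensity τ S x) =
        f x * ((∏ i, v i (x i)) * ratDensity τ S x) := by ring
    rw [this]
    have h2 : (∏ i, v i (x i)) * ratDensity τ S x = (S.card : ℝ)⁻¹ *
        ((∏ i, v i (x i)) * ∑ q ∈ S, ∏ i, bumpSum (τ i) q (x i)) := by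
      unfold ratDensity; ring
    rw [h2]
    refine mul_le_mul_of_nonneg_right (hfD x) ?_
    rw [← h2]
    exact mul_nonneg (Finset.prod_nonneg fun i _ => hv0 i _) (ratDensity_nonneg τ S x)

/-- A continuous cutoff of the set of points badly close to a rational point with
denominator `q`. -/
def nearWeight (τ : Fin 2 → ℝ) (q : ℕ) (x : Fin 2 → ℝ) : ℝ := ∏ i, nearCutoff (τ i) q (x i)

lemma nearWeight_continuous (τ : Fin 2 → ℝ) (q : ℕ) : Continuous (nearWeight τ q) :=
  continuous_finsetProd _ fun i _ => (nearCutoff_continuous _ _).comp (continuous_apply i)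

lemma nearWeight_nonneg (τ : Fin 2 → ℝ) (q : ℕ) (x : Fin 2 → ℝ) : 0 ≤ nearWeight τ q x :=
  Finset.prod_nonneg fun _ _ => nearCutoff_nonneg _ _ _

lemma nearWeight_le_one (τ : Fin 2 → ℝ) (q : ℕ) (x : Fin 2 → ℝ) : nearWeight τ q x ≤ 1 :=
  Finset.prod_le_one (fun _ _ => nearCutoff_nonneg _ _ _) fun _ _ => nearCutoff_le_one _ _ _

/-- A continuous cutoff of the dyadic-type cell of side `1 / R` with index `α`. -/
def cellWeight (R : ℝ) (α : Fin 2 → ℤ) (x : Fin 2 → ℝ) : ℝ := ∏ i, gridCutoff R (α i) (x i)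

lemma cellWeight_continuous (R : ℝ) (α : Fin 2 → ℤ) : Continuous (cellWeight R α) :=
  continuous_finsetProd _ fun i _ => (gridCutoff_continuous _ _).comp (continuous_apply i)

lemma cellWeight_nonneg (R : ℝ) (α : Fin 2 → ℤ) (x : Fin 2 → ℝ) : 0 ≤ cellWeight R α x :=
  Finset.prod_nonneg fun _ _ => gridCutoff_nonneg _ _ _

lemma cellWeight_le_one (R : ℝ) (α : Fin 2 → ℤ) (x : Fin 2 → ℝ) : cellWeight R α x ≤ 1 :=
  Finset.prod_le_one (fun _ _ => gridCutoff_nonneg _ _ _) fun _ _ => gridCutoff_le_one _ _ _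

lemma integral_nearWeight_mul_ratDensity_le {τ : Fin 2 → ℝ} (hτ : ∀ i, 0 ≤ τ i) {S : Finset ℕ}
    (hS : ∀ q ∈ S, q.Prime) {f : (Fin 2 → ℝ) → ℝ} (hf0 : ∀ x, 0 ≤ f x) {D : ℝ}
    (hfD : ∀ x, f x ≤ D) {q' : ℕ} (hq' : 0 < q') :
    ∫ x, nearWeight τ q' x * (f x * ratDensity τ S x) ≤
      25 * D * (q' : ℝ) ^ (-(τ 0 + τ 1)) := by
  have hD : 0 ≤ D := (hf0 0).trans (hfD 0)
  have hq0 : (0 : ℝ) < q' := by exact_mod_cast hq'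
  refine (integral_prod_mul_ratDensity_le τ (fun q hq => (hS q hq).pos)
    (fun i => nearCutoff_continuous (τ i) q') (fun i => nearCutoff_nonneg _ _)
    (fun i => nearCutoff_le_one _ _) hf0 hfD).trans ?_
  rw [mul_comm 25 D, mul_assoc]
  refine mul_le_mul_of_nonneg_left ?_ hD
  have hb : ∀ q ∈ S, ∏ i, ∫ t, nearCutoff (τ i) q' t * bumpSum (τ i) q t ≤
      25 * (q' : ℝ) ^ (-(τ 0 + τ 1)) := by
    intro q hq
    rw [Fin.prod_univ_two, neg_add, Real.rpow_add hq0]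
    have h0 := integral_nearCutoff_mul_bumpSum_le (hτ 0) (hS q hq) hq'
    have h1 := integral_nearCutoff_mul_bumpSum_le (hτ 1) (hS q hq) hq'
    calc _ ≤ (5 * (q' : ℝ) ^ (-(τ 0))) * (5 * (q' : ℝ) ^ (-(τ 1))) :=
          mul_le_mul h0 h1 (integral_nonneg fun t => mul_nonneg (nearCutoff_nonneg _ _ _)
            (bumpSum_nonneg _ _ _)) (by positivity)
      _ = _ := by ring
  have hs := Finset.sum_le_card_nsmul _ _ _ hb
  rw [nsmul_eq_mul] at hs
  calc _ ≤ (S.card : ℝ)⁻¹ * (S.card * (25 * (q' : ℝ) ^ (-(τ 0 + τ 1)))) := by gcongr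
    _ = ((S.card : ℝ)⁻¹ * S.card) * (25 * (q' : ℝ) ^ (-(τ 0 + τ 1))) := by ring
    _ ≤ 1 * (25 * (q' : ℝ) ^ (-(τ 0 + τ 1))) := by
        gcongr
        exact inv_mul_le_one
    _ = _ := one_mul _

lemma diag_factor_le {τ a q R : ℝ} (hq : 1 ≤ q) (hR : 0 < R) (hqR : q < R)
    (ha0 : 0 ≤ a) (ha1 : a ≤ 1) :
    4 * ((4 * q / R + 2) * min (1 / q) (32 * q ^ τ / R)) ≤
      768 * (q ^ (a * (1 + τ) - 1) * R ^ (-a)) := by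
  have hq0 : 0 < q := by linarith
  have h1 : 4 * q / R + 2 ≤ 6 := by
    have : 4 * q / R ≤ 4 := by rw [div_le_iff₀ hR]; linarith
    linarith
  have h2 : min (1 / q) (32 * q ^ τ / R) ≤ 32 * (q ^ (a * (1 + τ) - 1) * R ^ (-a)) := by
    set m := min (1 / q) (q ^ τ / R) with hm
    have hm0 : 0 < m := lt_min (by positivity) (by positivity)
    have e1 : min (1 / q) (32 * q ^ τ / R) ≤ 32 * m := by
      rw [hm, mul_min_of_nonneg _ _ (by norm_num : (0 : ℝ) ≤ 32)]
      refine min_le_min ?_ (by rw [mul_div_assoc])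
      have : 0 < 1 / q := by positivity
      linarith
    have e2 : m = m ^ (1 - a) * m ^ a := by
      rw [← Real.rpow_add hm0]; simp
    have e3 : m ^ (1 - a) * m ^ a ≤ (1 / q) ^ (1 - a) * (q ^ τ / R) ^ a := by
      refine mul_le_mul ?_ ?_ (by positivity) (by positivity)
      · exact Real.rpow_le_rpow hm0.le (min_le_left _ _) (by linarith)
      · exact Real.rpow_le_rpow hm0.le (min_le_right _ _) ha0
    have e4 : (1 / q) ^ (1 - a) * (q ^ τ / R) ^ a = q ^ (a * (1 + τ) - 1) * R ^ (-a) := by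
      rw [Real.div_rpow (by positivity) hR.le, one_div, Real.inv_rpow hq0.le,
        ← Real.rpow_neg hq0.le, ← Real.rpow_mul hq0.le, div_eq_mul_inv, ← Real.rpow_neg hR.le,
        ← mul_assoc, ← Real.rpow_add hq0]
      congr 2
      ring
    linarith
  calc _ ≤ 4 * (6 * (32 * (q ^ (a * (1 + τ) - 1) * R ^ (-a)))) := by
        gcongr
    _ = _ := by ring

lemma diag_product_le {τ a : Fin 2 → ℝ} (ha0 : ∀ i, 0 ≤ a i)
    (ha1 : ∀ i, a i ≤ 1) {s ε : ℝ} (hs : a 0 + a 1 = s) (hε : ε ≤ 1)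
    (haτ : a 0 * (1 + τ 0) + a 1 * (1 + τ 1) ≤ 3 - ε) {q R : ℝ} (hq : 1 ≤ q) (hR : 1 ≤ R) :
    ∏ i, 4 * ((4 * q / R + 2) * min (1 / q) (32 * q ^ τ i / R)) ≤
      768 ^ 2 * (q ^ (1 - ε) * R ^ (-s)) := by
  have hq0 : 0 < q := by linarith
  have hR0 : 0 < R := by linarith
  rw [Fin.prod_univ_two]
  rcases le_or_gt R q with h | h
  · have hf : ∀ i, 4 * ((4 * q / R + 2) * min (1 / q) (32 * q ^ τ i / R)) ≤
        768 * R ^ (-1 : ℝ) := by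
      intro i
      rw [Real.rpow_neg_one]
      have h1 : 2 ≤ 2 * q / R := by rw [le_div_iff₀ hR0]; linarith
      calc _ ≤ 4 * ((4 * q / R + 2 * q / R) * (1 / q)) := by
            gcongr
            exact min_le_left _ _
        _ = 24 * R⁻¹ := by field_simp; norm_num
        _ ≤ 768 * R⁻¹ := by gcongr; norm_num
    calc _ ≤ (768 * R ^ (-1 : ℝ)) * (768 * R ^ (-1 : ℝ)) := by
          refine mul_le_mul (hf 0) (hf 1) ?_ (by positivity)
          exact mul_nonneg (by norm_num) (mul_nonneg (by positivity)
            (le_min (by positivity) (by positivity)))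
      _ = 768 ^ 2 * (1 * R ^ (-2 : ℝ)) := by
          rw [show (-2 : ℝ) = -1 + -1 by norm_num, Real.rpow_add hR0]; ring
      _ ≤ _ := by
          gcongr
          · exact Real.one_le_rpow hq (by linarith)
          · linarith [ha1 0, ha1 1]
  · calc _ ≤ (768 * (q ^ (a 0 * (1 + τ 0) - 1) * R ^ (-a 0))) *
          (768 * (q ^ (a 1 * (1 + τ 1) - 1) * R ^ (-a 1))) := by
          refine mul_le_mul (diag_factor_le hq hR0 h (ha0 0) (ha1 0))
            (diag_factor_le hq hR0 h (ha0 1) (ha1 1)) ?_ (by positivity)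
          exact mul_nonneg (by norm_num) (mul_nonneg (by positivity)
            (le_min (by positivity) (by positivity)))
      _ = 768 ^ 2 * ((q ^ (a 0 * (1 + τ 0) - 1) * q ^ (a 1 * (1 + τ 1) - 1)) *
          (R ^ (-a 0) * R ^ (-a 1))) := by ring
      _ = 768 ^ 2 * (q ^ (a 0 * (1 + τ 0) - 1 + (a 1 * (1 + τ 1) - 1)) * R ^ (-s)) := by
          rw [← Real.rpow_add hq0, ← Real.rpow_add hR0, ← hs]
          congr 3
          ring
      _ ≤ _ := by
          gcongr
          linarith

/-- The index set of the cells of side `1 / R` meeting the unit square. -/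
def cellIndex (j : ℕ) : Finset (Fin 2 → ℤ) :=
  Fintype.piFinset fun _ => Finset.Icc (-1) (2 ^ j + 1)

/-- The mean-square mass of the cells of side `2⁻ʲ` for the density `f`. -/
def cellEnergy (f : (Fin 2 → ℝ) → ℝ) (j : ℕ) : ℝ :=
  ∑ α ∈ cellIndex j, (∫ x, cellWeight (2 ^ j) α x * f x) ^ 2

lemma cellEnergy_nonneg (f : (Fin 2 → ℝ) → ℝ) (j : ℕ) : 0 ≤ cellEnergy f j :=
  Finset.sum_nonneg fun _ _ => sq_nonneg _

lemma cellEnergy_mul_ratDensity_le {τ a : Fin 2 → ℝ} (hτ : ∀ i, 0 ≤ τ i) (ha0 : ∀ i, 0 ≤ a i)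
    (ha1 : ∀ i, a i ≤ 1) {s ε : ℝ} (hs : a 0 + a 1 = s) (hε : ε ≤ 1)
    (haτ : a 0 * (1 + τ 0) + a 1 * (1 + τ 1) ≤ 3 - ε) {S : Finset ℕ} (hS : ∀ q ∈ S, q.Prime)
    {Q : ℝ} (hQ : ∀ q ∈ S, (q : ℝ) ≤ Q) (hcard : Q ^ (1 - ε) ≤ S.card)
    {f : (Fin 2 → ℝ) → ℝ} (hf0 : ∀ x, 0 ≤ f x) {D : ℝ} (hfD : ∀ x, f x ≤ D) (j : ℕ) :
    cellEnergy (fun x => f x * ratDensity τ S x) j ≤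
      D ^ 2 * ((768 ^ 2 + 160 ^ 2) * ((2 : ℝ) ^ j) ^ (-s)) := by
  classical
  have hD : 0 ≤ D := (hf0 0).trans (hfD 0)
  set R : ℝ := 2 ^ j with hR
  have hR1 : 1 ≤ R := one_le_pow₀ (by norm_num)
  have hR0 : 0 < R := by linarith
  set m : Fin 2 → ℕ → ℤ → ℝ := fun i q b => ∫ t, gridCutoff R b t * bumpSum (τ i) q t with hm
  set c : ℝ := (S.card : ℝ)⁻¹ with hc
  have hc0 : 0 ≤ c := by positivity
  have h1 : cellEnergy (fun x => f x * ratDensity τ S x) j ≤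
      ∑ α ∈ cellIndex j, (D * (c * ∑ q ∈ S, ∏ i, m i q (α i))) ^ 2 := by
    refine Finset.sum_le_sum fun α _ => ?_
    refine pow_le_pow_left₀ ?_ ?_ 2
    · exact integral_nonneg fun x => mul_nonneg (cellWeight_nonneg _ _ _)
        (mul_nonneg (hf0 x) (ratDensity_nonneg _ _ _))
    · exact integral_prod_mul_ratDensity_le τ (fun q hq => (hS q hq).pos)
        (fun i => gridCutoff_continuous R (α i)) (fun i => gridCutoff_nonneg _ _)
        (fun i => gridCutoff_le_one _ _) hf0 hfD
  have h2 : ∑ α ∈ cellIndex j, (D * (c * ∑ q ∈ S, ∏ i, m i q (α i))) ^ 2 =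
      D ^ 2 * (c * (c * ∑ q ∈ S, ∑ q' ∈ S, ∏ i,
        ∑ b ∈ Finset.Icc (-1 : ℤ) (2 ^ j + 1), m i q b * m i q' b)) := by
    have e : ∀ α : Fin 2 → ℤ, (D * (c * ∑ q ∈ S, ∏ i, m i q (α i))) ^ 2 =
        D ^ 2 * (c * (c * ∑ q ∈ S, ∑ q' ∈ S, ∏ i, (m i q (α i) * m i q' (α i)))) := by
      intro α
      simp_rw [Finset.prod_mul_distrib]
      rw [← Finset.sum_mul_sum]
      ring
    simp_rw [e, ← Finset.mul_sum]
    congr 3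
    rw [Finset.sum_comm]
    refine Finset.sum_congr rfl fun q _ => ?_
    rw [Finset.sum_comm]
    refine Finset.sum_congr rfl fun q' _ => ?_
    rw [Finset.prod_univ_sum]
    rfl
  rw [h2] at h1
  refine h1.trans ?_
  have h0 : ∀ i q q', 0 ≤ ∑ b ∈ Finset.Icc (-1 : ℤ) (2 ^ j + 1), m i q b * m i q' b :=
    fun i q q' => Finset.sum_nonneg fun b _ => mul_nonneg
      (integral_nonneg fun t => mul_nonneg (gridCutoff_nonneg _ _ _) (bumpSum_nonneg _ _ _))
      (integral_nonneg fun t => mul_nonneg (gridCutoff_nonneg _ _ _) (bumpSum_nonneg _ _ _))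
  have hRs : R ^ (-2 : ℝ) ≤ R ^ (-s) :=
    Real.rpow_le_rpow_of_exponent_le hR1 (by linarith [ha1 0, ha1 1])
  have hdiag : ∀ q ∈ S, ∏ i, ∑ b ∈ Finset.Icc (-1 : ℤ) (2 ^ j + 1), m i q b * m i q b ≤
      768 ^ 2 * (S.card * R ^ (-s)) := by
    intro q hq
    have hq1 : (1 : ℝ) ≤ q := by exact_mod_cast (hS q hq).one_le
    calc _ ≤ ∏ i, 4 * ((4 * q / R + 2) * min (1 / (q : ℝ)) (32 * (q : ℝ) ^ τ i / R)) :=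
          Finset.prod_le_prod (fun i _ => h0 i q q) fun i _ =>
            sum_sq_gridCutoff_le (hτ i) (hS q hq).pos hR0 _
      _ ≤ 768 ^ 2 * ((q : ℝ) ^ (1 - ε) * R ^ (-s)) :=
          diag_product_le ha0 ha1 hs hε haτ hq1 hR1
      _ ≤ _ := by
          gcongr
          refine le_trans ?_ hcard
          exact Real.rpow_le_rpow (by positivity) (hQ q hq) (by linarith)
  have hoff : ∀ q ∈ S, ∀ q' ∈ S, q ≠ q' →
      ∏ i, ∑ b ∈ Finset.Icc (-1 : ℤ) (2 ^ j + 1), m i q b * m i q' b ≤ 160 ^ 2 * R ^ (-s) := by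
    intro q hq q' hq' hne
    calc _ ≤ ∏ i : Fin 2, 160 / R :=
          Finset.prod_le_prod (fun i _ => h0 i q q') fun i _ =>
            sum_gridCutoff_mul_le_of_ne (hτ i) (hS q hq) (hS q' hq') hne hR0 _
      _ = 160 ^ 2 * R ^ (-2 : ℝ) := by
          rw [Fin.prod_univ_two, Real.rpow_neg hR0.le, Real.rpow_two]
          field_simp
      _ ≤ _ := by gcongr
  have hrow : ∀ q ∈ S, ∑ q' ∈ S, ∏ i, ∑ b ∈ Finset.Icc (-1 : ℤ) (2 ^ j + 1), m i q b * m i q' b ≤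
      S.card * ((768 ^ 2 + 160 ^ 2) * R ^ (-s)) := by
    intro q hq
    have hall : ∀ q' ∈ S, ∏ i, ∑ b ∈ Finset.Icc (-1 : ℤ) (2 ^ j + 1), m i q b * m i q' b ≤
        160 ^ 2 * R ^ (-s) + if q' = q then 768 ^ 2 * (S.card * R ^ (-s)) else 0 := by
      intro q' hq'
      split_ifs with h
      · subst h
        have := hdiag q' hq
        have : 0 ≤ 160 ^ 2 * R ^ (-s) := by positivity
        linarith
      · rw [add_zero]
        exact hoff q hq q' hq' (Ne.symm h)
    refine (Finset.sum_le_sum hall).trans (le_of_eq ?_)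
    rw [Finset.sum_add_distrib, Finset.sum_const, nsmul_eq_mul, Finset.sum_ite_eq' , if_pos hq]
    ring
  have htot := Finset.sum_le_card_nsmul _ _ _ hrow
  rw [nsmul_eq_mul] at htot
  refine mul_le_mul_of_nonneg_left ?_ (sq_nonneg D)
  have hcS : c * S.card ≤ 1 := inv_mul_le_one
  have hcS0 : 0 ≤ c * S.card := by positivity
  calc _ ≤ c * (c * (S.card * (S.card * ((768 ^ 2 + 160 ^ 2) * R ^ (-s))))) := by gcongr
    _ = (c * S.card) * (c * S.card) * ((768 ^ 2 + 160 ^ 2) * R ^ (-s)) := by ring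
    _ ≤ 1 * ((768 ^ 2 + 160 ^ 2) * R ^ (-s)) := by
        gcongr
        exact mul_le_one₀ hcS hcS0 hcS
    _ = _ := one_mul _

/-- The primes in the interval `(M, M²]`. -/
def levelPrimes (M : ℕ) : Finset ℕ := {q ∈ Finset.Ioc M (M ^ 2) | q.Prime}

lemma prime_of_mem_levelPrimes {M q : ℕ} (h : q ∈ levelPrimes M) : q.Prime :=
  (Finset.mem_filter.1 h).2

lemma lt_of_mem_levelPrimes {M q : ℕ} (h : q ∈ levelPrimes M) : M < q :=
  (Finset.mem_Ioc.1 (Finset.mem_filter.1 h).1).1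

lemma le_of_mem_levelPrimes {M q : ℕ} (h : q ∈ levelPrimes M) : q ≤ M ^ 2 :=
  (Finset.mem_Ioc.1 (Finset.mem_filter.1 h).1).2

lemma primeCounting_le_card_levelPrimes (M : ℕ) :
    Nat.primeCounting (M ^ 2) ≤ M + (levelPrimes M).card := by
  have h : Nat.primeCounting (M ^ 2) = (Finset.filter Nat.Prime (Finset.range (M ^ 2 + 1))).card := by
    rw [Nat.primeCounting, Nat.primeCounting', Nat.count_eq_card_filter_range]
  rw [h]
  have hsub : Finset.filter Nat.Prime (Finset.range (M ^ 2 + 1)) ⊆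
      Finset.Ioc 0 M ∪ levelPrimes M := by
    intro q hq
    rw [Finset.mem_filter, Finset.mem_range] at hq
    rw [Finset.mem_union, levelPrimes, Finset.mem_filter, Finset.mem_Ioc, Finset.mem_Ioc]
    have := hq.2.pos
    by_cases hM : q ≤ M
    · exact Or.inl ⟨this, hM⟩
    · exact Or.inr ⟨⟨by omega, by omega⟩, hq.2⟩
  refine (Finset.card_le_card hsub).trans ((Finset.card_union_le _ _).trans ?_)
  simp

lemma eventually_rpow_le_card_levelPrimes {ε : ℝ} (hε : 0 < ε) :
    ∀ᶠ M : ℕ in Filter.atTop, ((M : ℝ) ^ 2) ^ (1 - ε) ≤ (levelPrimes M).card := by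
  set δ := min ε (1 / 2) with hδ
  have hδ0 : 0 < δ := lt_min hε (by norm_num)
  have hlim : ∀ᶠ n : ℝ in Filter.atTop, Real.log n ≤ 1 / 16 * n ^ δ := by
    have := (isLittleO_log_rpow_atTop hδ0).bound (by norm_num : (0 : ℝ) < 1 / 16)
    filter_upwards [this, Filter.eventually_ge_atTop 1] with n hn h1
    rw [Real.norm_of_nonneg (Real.log_nonneg h1), Real.norm_of_nonneg (by positivity)] at hn
    exact hn
  have hlim' : ∀ᶠ M : ℕ in Filter.atTop, Real.log ((M : ℝ) ^ 2) ≤ 1 / 16 * ((M : ℝ) ^ 2) ^ δ :=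
    ((Filter.tendsto_pow_atTop two_ne_zero).comp tendsto_natCast_atTop_atTop).eventually hlim
  filter_upwards [hlim', Filter.eventually_ge_atTop 4] with M hM h4
  have hM4 : (4 : ℝ) ≤ M := by exact_mod_cast h4
  set n : ℝ := (M : ℝ) ^ 2 with hn
  have hn16 : 16 ≤ n := by nlinarith
  have hn0 : 0 < n := by linarith
  have hlog : 0 < Real.log n := Real.log_pos (by linarith)
  have hpi := Chebyshev.pi_ge (M ^ 2)
  push_cast at hpi
  rw [← hn] at hpi
  have hcard : (Nat.primeCounting (M ^ 2) : ℝ) ≤ M + (levelPrimes M).card := by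
    exact_mod_cast primeCounting_le_card_levelPrimes M
  have h1 : Real.log (n + 1) ≤ Real.log 2 + Real.log n := by
    rw [← Real.log_mul (by norm_num) hn0.ne']
    exact Real.log_le_log (by linarith) (by linarith)
  have hnδ : n ^ δ ≤ n := by
    calc n ^ δ ≤ n ^ (1 : ℝ) := Real.rpow_le_rpow_of_exponent_le (by linarith)
          ((min_le_right _ _).trans (by norm_num))
      _ = n := Real.rpow_one n
  have hl2 := Real.log_two_gt_d9
  have hl2' := Real.log_two_lt_d9
  have h2 : n ^ (1 - ε) * Real.log n ≤ 1 / 16 * n := by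
    calc n ^ (1 - ε) * Real.log n ≤ n ^ (1 - δ) * (1 / 16 * n ^ δ) := by
          gcongr
          · linarith
          · exact min_le_left _ _
      _ = 1 / 16 * (n ^ (1 - δ) * n ^ δ) := by ring
      _ = 1 / 16 * n := by rw [← Real.rpow_add hn0]; simp
  have h3 : M * Real.log n ≤ 1 / 16 * n := by
    have hMn : (M : ℝ) ≤ n ^ (1 - δ) := by
      calc (M : ℝ) = n ^ (1 / 2 : ℝ) := by
            rw [hn, ← Real.rpow_natCast, ← Real.rpow_mul (by positivity)]; simp
        _ ≤ n ^ (1 - δ) := Real.rpow_le_rpow_of_exponent_le (by linarith)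
          (by linarith [min_le_right ε (1 / 2)])
    calc M * Real.log n ≤ n ^ (1 - δ) * (1 / 16 * n ^ δ) := by gcongr
      _ = 1 / 16 * (n ^ (1 - δ) * n ^ δ) := by ring
      _ = 1 / 16 * n := by rw [← Real.rpow_add hn0]; simp
  have h4 : (n * Real.log 2 - Real.log (n + 1)) / Real.log n ≥ n ^ (1 - ε) + M := by
    rw [ge_iff_le, le_div_iff₀ hlog, add_mul]
    nlinarith
  linarith

lemma abs_integral_mul_prod_sub_sum_le {q : ℕ} (hq : 0 < q) {k : Fin 2 → ℕ → ℝ → ℝ}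
    (hk0 : ∀ i p t, 0 ≤ k i p t) (hki : ∀ i p, Integrable (k i p))
    (hk1 : ∀ i p, ∫ t, k i p t = 1 / q) (hks : ∀ i p t, k i p t ≠ 0 → |t - p / q| ≤ 1 / q) {G : (Fin 2 → ℝ) → ℝ} (hG : Continuous G)
    {C : ℝ} (hC : ∀ x, |G x| ≤ C) {η : ℝ} (hη : ∀ x y, dist x y ≤ 1 / q → |G x - G y| ≤ η) :
    |(∫ x : Fin 2 → ℝ, G x * ∏ i, ∑ p ∈ Finset.Ioo 0 q, k i p (x i)) -
      ∑ P ∈ Fintype.piFinset fun _ : Fin 2 => Finset.Ioo 0 q,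
        G (fun i => (P i : ℝ) / q) * (1 / q) ^ 2| ≤ η := by
  have hq0 : (0 : ℝ) < q := by exact_mod_cast hq
  have hη0 : 0 ≤ η := (abs_nonneg _).trans (hη 0 0 (by simp))
  set T := Fintype.piFinset fun _ : Fin 2 => Finset.Ioo 0 q with hT
  have hKi : ∀ P : Fin 2 → ℕ, Integrable fun x : Fin 2 → ℝ => ∏ i, k i (P i) (x i) := fun P =>
    Integrable.fintype_prod (f := fun i t => k i (P i) t) fun i => hki i (P i)
  have hK1 : ∀ P : Fin 2 → ℕ, ∫ x : Fin 2 → ℝ, ∏ i, k i (P i) (x i) = (1 / (q : ℝ)) ^ 2 := by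
    intro P
    rw [integral_fintype_prod_volume_eq_prod fun i t => k i (P i) t]
    simp only [hk1, Fin.prod_univ_two, sq]
  have hGK : ∀ P : Fin 2 → ℕ, Integrable fun x : Fin 2 → ℝ => G x * ∏ i, k i (P i) (x i) := fun P =>
    (hKi P).bdd_mul (c := C) hG.aestronglyMeasurable (ae_of_all _ hC)
  have e1 : ∫ x : Fin 2 → ℝ, G x * ∏ i, ∑ p ∈ Finset.Ioo 0 q, k i p (x i) =
      ∑ P ∈ T, ∫ x : Fin 2 → ℝ, G x * ∏ i, k i (P i) (x i) := by
    simp_rw [Finset.prod_univ_sum, Finset.mul_sum]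
    exact integral_finsetSum _ fun P _ => hGK P
  rw [e1, ← Finset.sum_sub_distrib]
  have e2 : ∀ P ∈ T, |(∫ x : Fin 2 → ℝ, G x * ∏ i, k i (P i) (x i)) -
      G (fun i => (P i : ℝ) / q) * (1 / q) ^ 2| ≤ η * (1 / q) ^ 2 := by
    intro P _
    rw [← hK1 P, ← integral_const_mul, ← integral_const_mul, ← integral_sub (hGK P)
      ((hKi P).const_mul _)]
    refine abs_integral_le_integral_abs.trans (integral_mono_of_nonneg ?_ ?_ ?_)
    · exact ae_of_all _ fun x => abs_nonneg _
    · exact (hKi P).const_mul _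
    · refine ae_of_all _ fun x => ?_
      have hn : 0 ≤ ∏ i, k i (P i) (x i) := Finset.prod_nonneg fun i _ => hk0 _ _ _
      simp only
      rw [← sub_mul, abs_mul, abs_of_nonneg hn]
      by_cases hz : ∏ i, k i (P i) (x i) = 0
      · rw [hz]; simp
      refine mul_le_mul_of_nonneg_right (hη _ _ ?_) hn
      refine (dist_pi_le_iff (by positivity)).2 fun i => ?_
      rw [Real.dist_eq]
      exact hks _ _ _ (Finset.prod_ne_zero_iff.1 hz i (Finset.mem_univ i))
  refine (Finset.abs_sum_le_sum_abs _ _).trans ((Finset.sum_le_card_nsmul _ _ _ e2).trans ?_)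
  have hcard : (T.card : ℝ) ≤ (q : ℝ) ^ 2 := by
    rw [hT, Fintype.card_piFinset, Fin.prod_univ_two, Nat.card_Ioo, sq]
    have : q - 0 - 1 ≤ q := by omega
    exact_mod_cast Nat.mul_le_mul this this
  rw [nsmul_eq_mul]
  calc (T.card : ℝ) * (η * (1 / q) ^ 2) ≤ (q : ℝ) ^ 2 * (η * (1 / q) ^ 2) := by gcongr
    _ = η := by field_simp

lemma integral_mul_prod_box {q : ℕ} (hq : 0 < q) {G : (Fin 2 → ℝ) → ℝ}
    (hG : ∀ x, G x ≠ 0 → ∀ i, x i ∈ Ico (1 / (q : ℝ)) 1) :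
    ∫ x : Fin 2 → ℝ, G x * ∏ i, ∑ p ∈ Finset.Ioo 0 q,
      (Ico ((p : ℝ) / q) ((p + 1) / q)).indicator (fun _ => (1 : ℝ)) (x i) = ∫ x, G x := by
  have hq0 : (0 : ℝ) < q := by exact_mod_cast hq
  refine integral_congr_ae (ae_of_all _ fun x => ?_)
  simp only
  by_cases hx : G x = 0
  · simp [hx]
  rw [Finset.prod_eq_one, mul_one]
  intro i _
  obtain ⟨h1, h2⟩ := hG x hx i
  rw [div_le_iff₀ hq0] at h1
  have hn0 : 0 ≤ x i * q := by linarith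
  have hiff : ∀ p : ℕ, x i ∈ Ico ((p : ℝ) / q) ((p + 1) / q) ↔ p = ⌊x i * q⌋₊ := by
    intro p
    rw [mem_Ico, div_le_iff₀ hq0, lt_div_iff₀ hq0, eq_comm, Nat.floor_eq_iff hn0]
  have hmem : ⌊x i * q⌋₊ ∈ Finset.Ioo 0 q := by
    rw [Finset.mem_Ioo]
    refine ⟨Nat.floor_pos.2 h1, (Nat.floor_lt hn0).2 ?_⟩
    nlinarith
  rw [Finset.sum_eq_single_of_mem _ hmem]
  · exact indicator_of_mem ((hiff _).2 rfl) _
  · intro p _ hp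
    exact indicator_of_notMem (fun h => hp ((hiff p).1 h)) _

lemma abs_integral_mul_prod_bumpSum_sub_le {τ : Fin 2 → ℝ} (hτ : ∀ i, 0 ≤ τ i) {q : ℕ}
    (hq : 0 < q) {G : (Fin 2 → ℝ) → ℝ} (hG : Continuous G) {C : ℝ} (hC : ∀ x, |G x| ≤ C) {η : ℝ}
    (hη : ∀ x y, dist x y ≤ 1 / q → |G x - G y| ≤ η)
    (hGs : ∀ x, G x ≠ 0 → ∀ i, x i ∈ Ico (1 / (q : ℝ)) 1) :
    |(∫ x : Fin 2 → ℝ, G x * ∏ i, bumpSum (τ i) q (x i)) - ∫ x, G x| ≤ 2 * η := by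
  have hq0 : (0 : ℝ) < q := by exact_mod_cast hq
  have h1 := abs_integral_mul_prod_sub_sum_le hq (k := fun i p => bumpAt (τ i) q p)
    (fun i p t => bumpAt_nonneg _ _ _ _) (fun i p => bumpAt_integrable _ hq p)
    (fun i p => bumpAt_integral _ hq p) ?_ hG hC hη
  · have h2 := abs_integral_mul_prod_sub_sum_le hq
      (k := fun _ p => (Ico ((p : ℝ) / q) ((p + 1) / q)).indicator (fun _ => (1 : ℝ)))
      (fun i p t => indicator_nonneg (fun _ _ => zero_le_one) t) ?_ ?_ ?_ hG hC hη
    · rw [integral_mul_prod_box hq hGs] at h2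
      rw [abs_le] at h1 h2 ⊢
      unfold bumpSum
      constructor <;> linarith
    · exact fun i p => (integrable_indicator_iff measurableSet_Ico).2
        (integrableOn_const (by simp))
    · intro i p
      rw [integral_indicator measurableSet_Ico, setIntegral_const, smul_eq_mul, mul_one,
        Real.volume_real_Ico_of_le (by gcongr; linarith)]
      ring
    · intro i p t ht
      have := mem_of_indicator_ne_zero (s := Ico ((p : ℝ) / q) ((p + 1) / q)) ht
      rw [mem_Ico, add_div] at this
      rw [abs_le]
      constructor <;> linarith
  · intro i p t ht
    have h := mem_of_bumpAt_ne_zero hq ht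
    have hA := rpow_neg_le_one_of_pos hq (hτ i)
    have hA0 : 0 ≤ (q : ℝ) ^ (-τ i) := by positivity
    have e : t - p / q = (q * t - p) / q := by field_simp
    rw [e, abs_div, abs_of_pos hq0, abs_of_nonneg (by linarith [h.1])]
    gcongr
    linarith [h.2]

/-- The average densities equidistribute. -/
lemma tendsto_integral_mul_ratDensity {τ : Fin 2 → ℝ} (hτ : ∀ i, 0 ≤ τ i)
    {G : (Fin 2 → ℝ) → ℝ} (hG : Continuous G) {K : Set (Fin 2 → ℝ)} (hK : IsCompact K)
    (hKI : ∀ x ∈ K, ∀ i, x i ∈ Ioo (0 : ℝ) 1) (hGK : ∀ x, G x ≠ 0 → x ∈ K) :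
    Filter.Tendsto (fun M => ∫ x, G x * ratDensity τ (levelPrimes M) x) Filter.atTop
      (nhds (∫ x, G x)) := by
  have hcs : HasCompactSupport G := HasCompactSupport.intro hK fun x hx => by
    by_contra h
    exact hx (hGK x h)
  have huc : UniformContinuous G := hcs.uniformContinuous_of_continuous hG
  obtain ⟨C, hC⟩ := hcs.exists_bound_of_continuous hG
  obtain ⟨δ, hδ0, hδ⟩ : ∃ δ > 0, ∀ x ∈ K, ∀ i, δ ≤ x i := by
    rcases K.eq_empty_or_nonempty with rfl | hne
    · exact ⟨1, one_pos, by simp⟩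
    obtain ⟨y, hy, hmin⟩ := hK.exists_isMinOn hne
      (f := fun x : Fin 2 → ℝ => min (x 0) (x 1)) (by fun_prop)
    refine ⟨min (y 0) (y 1), lt_min (hKI y hy 0).1 (hKI y hy 1).1, fun x hx i => ?_⟩
    have := hmin hx
    simp only [mem_ofPred_eq] at this
    fin_cases i
    · exact this.trans (min_le_left _ _)
    · exact this.trans (min_le_right _ _)
  rw [Metric.tendsto_atTop]
  intro ε hε
  obtain ⟨δ', hδ'0, hδ'⟩ := Metric.uniformContinuous_iff.1 huc (ε / 4) (by linarith)
  obtain ⟨N, hN⟩ := exists_nat_one_div_lt (lt_min hδ0 hδ'0)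
  have hev := eventually_rpow_le_card_levelPrimes (ε := 1 / 2) (by norm_num)
  obtain ⟨N', hN'⟩ := Filter.eventually_atTop.1 hev
  refine ⟨max (N + 1) N', fun M hM => ?_⟩
  have hM1 : N + 1 ≤ M := (le_max_left _ _).trans hM
  have hM0 : (0 : ℝ) < M := by exact_mod_cast (by omega : 0 < M)
  have hcard : (0 : ℝ) < (levelPrimes M).card :=
    lt_of_lt_of_le (by positivity) (hN' M ((le_max_right _ _).trans hM))
  have hq : ∀ q ∈ levelPrimes M,
      |(∫ x : Fin 2 → ℝ, G x * ∏ i, bumpSum (τ i) q (x i)) - ∫ x, G x| ≤ ε / 2 := by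
    intro q hq
    have hqM := lt_of_mem_levelPrimes hq
    have hqp := (prime_of_mem_levelPrimes hq).pos
    have h1 : 1 / (q : ℝ) < min δ δ' := by
      refine lt_of_le_of_lt ?_ hN
      have : ((N + 1 : ℕ) : ℝ) ≤ q := by exact_mod_cast (by omega : N + 1 ≤ q)
      push_cast at this
      gcongr
    have := abs_integral_mul_prod_bumpSum_sub_le hτ hqp hG hC (η := ε / 4) ?_ ?_
    · linarith
    · intro x y hxy
      have := hδ' (lt_of_le_of_lt hxy (h1.trans_le (min_le_right _ _)))
      rw [Real.dist_eq] at this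
      exact this.le
    · intro x hx i
      have hxK := hGK x hx
      exact ⟨(h1.le.trans (min_le_left _ _)).trans (hδ x hxK i), (hKI x hxK i).2⟩
  set S := levelPrimes M with hS
  have hint : ∀ q ∈ S, Integrable fun x : Fin 2 → ℝ => G x * ∏ i, bumpSum (τ i) q (x i) := by
    intro q _
    refine Continuous.integrable_of_hasCompactSupport ?_ hcs.mul_right
    exact hG.mul (continuous_finsetProd _ fun i _ =>
      (bumpSum_continuous _ _).comp (continuous_apply i))
  have e : ∫ x, G x * ratDensity τ S x = (S.card : ℝ)⁻¹ *
      ∑ q ∈ S, ∫ x : Fin 2 → ℝ, G x * ∏ i, bumpSum (τ i) q (x i) := by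
    rw [← integral_finsetSum _ hint, ← integral_const_mul]
    refine integral_congr_ae (ae_of_all _ fun x => ?_)
    simp only [ratDensity]
    rw [← Finset.mul_sum]
    ring
  have e' : ∫ x, G x = (S.card : ℝ)⁻¹ * ∑ q ∈ S, ∫ x, G x := by
    rw [Finset.sum_const, nsmul_eq_mul, inv_mul_cancel_left₀ hcard.ne']
  rw [e, Real.dist_eq, e', ← mul_sub, ← Finset.sum_sub_distrib, abs_mul, abs_of_pos (inv_pos.2 hcard)]
  have h2 := (Finset.abs_sum_le_sum_abs _ _).trans (Finset.sum_le_card_nsmul _ _ _ hq)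
  rw [nsmul_eq_mul] at h2
  calc _ ≤ (S.card : ℝ)⁻¹ * (S.card * (ε / 2)) :=
        mul_le_mul_of_nonneg_left h2 (inv_pos.2 hcard).le
    _ = ε / 2 := inv_mul_cancel_left₀ hcard.ne' _
    _ < ε := by linarith

/-- The exponents `s` for which the construction produces a measure of dimension at least `s`. -/
def AdmissibleExponent (τ : Fin 2 → ℝ) (s : ℝ) : Prop :=
  ∃ a : Fin 2 → ℝ, ∃ ε : ℝ, 0 < ε ∧ ε ≤ 1 ∧ (∀ i, 0 ≤ a i) ∧ (∀ i, a i ≤ 1) ∧ s < a 0 + a 1 ∧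
    a 0 * (1 + τ 0) + a 1 * (1 + τ 1) ≤ 3 - ε

/-- The quantities to be controlled for a density `f`: the mass near the rational points with
denominator `k + 1` and the contribution of the scale `2⁻ᵏ` to the `s`-energy. -/
def energyTerm (τ : Fin 2 → ℝ) (s : ℝ) (f : (Fin 2 → ℝ) → ℝ) (k : ℕ) : ℝ :=
  (∫ x, nearWeight τ (k + 1) x * f x) + ((2 : ℝ) ^ k) ^ s * cellEnergy f k

/-- Continuous probability densities supported in `K`. -/
structure IsDensityOn (K : Set (Fin 2 → ℝ)) (f : (Fin 2 → ℝ) → ℝ) : Prop where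
  continuous : Continuous f
  nonneg : ∀ x, 0 ≤ f x
  integral_eq_one : ∫ x, f x = 1
  mem_of_ne_zero : ∀ x, f x ≠ 0 → x ∈ K

lemma energyTerm_nonneg (τ : Fin 2 → ℝ) (s : ℝ) {f : (Fin 2 → ℝ) → ℝ} (hf : ∀ x, 0 ≤ f x)
    (k : ℕ) : 0 ≤ energyTerm τ s f k :=
  add_nonneg (integral_nonneg fun x => mul_nonneg (nearWeight_nonneg _ _ _) (hf x))
    (mul_nonneg (by positivity) (cellEnergy_nonneg _ _))

lemma IsDensityOn.bddAbove {K : Set (Fin 2 → ℝ)} (hK : IsCompact K) {f : (Fin 2 → ℝ) → ℝ}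
    (hf : IsDensityOn K f) : ∃ D, ∀ x, f x ≤ D := by
  have hcs : HasCompactSupport f := HasCompactSupport.intro hK fun x hx => by
    by_contra h
    exact hx (hf.mem_of_ne_zero x h)
  obtain ⟨C, hC⟩ := hcs.exists_bound_of_continuous hf.continuous
  exact ⟨C, fun x => (le_abs_self _).trans (hC x)⟩

lemma exists_summable_energyTerm_bound {τ : Fin 2 → ℝ} (hτ : ∀ i, 0 ≤ τ i)
    (hsum : 1 < τ 0 + τ 1) {s : ℝ} (hs : AdmissibleExponent τ s) (D : ℝ) :
    ∃ b : ℕ → ℝ, Summable b ∧ ∃ M₀ : ℕ, ∀ M ≥ M₀, ∀ f : (Fin 2 → ℝ) → ℝ, (∀ x, 0 ≤ f x) →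
      (∀ x, f x ≤ D) → ∀ k, energyTerm τ s (fun x => f x * ratDensity τ (levelPrimes M) x) k ≤
        b k := by
  obtain ⟨a, ε, hε0, hε1, ha0, ha1, hsa, haτ⟩ := hs
  obtain ⟨M₀, hM₀⟩ := Filter.eventually_atTop.1 (eventually_rpow_le_card_levelPrimes hε0)
  refine ⟨fun k => 25 * D * ((k + 1 : ℕ) : ℝ) ^ (-(τ 0 + τ 1)) +
    D ^ 2 * (768 ^ 2 + 160 ^ 2) * ((2 : ℝ) ^ (s - (a 0 + a 1))) ^ k, ?_, M₀, ?_⟩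
  · refine Summable.add (Summable.mul_left _ ?_) (Summable.mul_left _ ?_)
    · exact (summable_nat_add_iff 1).2 (Real.summable_nat_rpow.2 (by linarith))
    · refine summable_geometric_of_lt_one (by positivity) ?_
      exact Real.rpow_lt_one_of_one_lt_of_neg (by norm_num) (by linarith)
  · intro M hM f hf0 hfD k
    refine add_le_add ?_ ?_
    · exact integral_nearWeight_mul_ratDensity_le hτ (fun q hq => prime_of_mem_levelPrimes hq)
        hf0 hfD k.succ_pos
    · have h := cellEnergy_mul_ratDensity_le hτ ha0 ha1 rfl hε1 haτ
        (fun q hq => prime_of_mem_levelPrimes hq) (Q := (M : ℝ) ^ 2)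
        (fun q hq => by exact_mod_cast le_of_mem_levelPrimes hq) (hM₀ M hM) hf0 hfD k
      calc _ ≤ ((2 : ℝ) ^ k) ^ s *
            (D ^ 2 * ((768 ^ 2 + 160 ^ 2) * ((2 : ℝ) ^ k) ^ (-(a 0 + a 1)))) := by gcongr
        _ = D ^ 2 * (768 ^ 2 + 160 ^ 2) * (((2 : ℝ) ^ k) ^ s * ((2 : ℝ) ^ k) ^ (-(a 0 + a 1))) := by
            ring
        _ = _ := by
            rw [← Real.rpow_add (by positivity), ← Real.rpow_natCast (2 : ℝ) k,
              ← Real.rpow_mul (by norm_num), ← Real.rpow_natCast _ k,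
              ← Real.rpow_mul (by norm_num), mul_comm (k : ℝ), ← sub_eq_add_neg]

lemma tendsto_energyTerm {τ : Fin 2 → ℝ} (hτ : ∀ i, 0 ≤ τ i) (s : ℝ) {K : Set (Fin 2 → ℝ)}
    (hK : IsCompact K) (hKI : ∀ x ∈ K, ∀ i, x i ∈ Ioo (0 : ℝ) 1) {f : (Fin 2 → ℝ) → ℝ}
    (hf : IsDensityOn K f) {c : ℕ → ℝ} (hc : Filter.Tendsto c Filter.atTop (nhds 1)) (k : ℕ) :
    Filter.Tendsto
      (fun M => energyTerm τ s (fun x => c M * f x * ratDensity τ (levelPrimes M) x) k)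
      Filter.atTop (nhds (energyTerm τ s f k)) := by
  have h : ∀ w : (Fin 2 → ℝ) → ℝ, Continuous w → Filter.Tendsto
      (fun M => ∫ x, w x * (c M * f x * ratDensity τ (levelPrimes M) x)) Filter.atTop
      (nhds (∫ x, w x * f x)) := by
    intro w hw
    have h1 := tendsto_integral_mul_ratDensity hτ (G := fun x => w x * f x)
      (hw.mul hf.continuous) hK hKI fun x hx => hf.mem_of_ne_zero x (right_ne_zero_of_mul hx)
    have h2 := hc.mul h1
    rw [one_mul] at h2
    refine h2.congr fun M => ?_
    rw [← integral_const_mul]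
    refine integral_congr_ae (ae_of_all _ fun x => ?_)
    simp only
    ring
  refine (h _ (nearWeight_continuous τ (k + 1))).add (Filter.Tendsto.const_mul _ ?_)
  exact tendsto_finsetSum _ fun α _ => (h _ (cellWeight_continuous _ α)).pow 2

/-- The points within the target distance of a rational point whose denominator lies in `S`. -/
def ratNeighborhood (τ : Fin 2 → ℝ) (S : Finset ℕ) : Set (Fin 2 → ℝ) :=
  ⋃ q ∈ S, ⋃ P ∈ Fintype.piFinset fun _ : Fin 2 => Finset.Ioo 0 q,
    {x | ∀ i, (q : ℝ) * x i - (P i : ℕ) ∈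
      Icc (1 / 4 * (q : ℝ) ^ (-(τ i))) (1 / 2 * (q : ℝ) ^ (-(τ i)))}

lemma isClosed_ratNeighborhood (τ : Fin 2 → ℝ) (S : Finset ℕ) :
    IsClosed (ratNeighborhood τ S) := by
  refine isClosed_biUnion_finset fun q _ => isClosed_biUnion_finset fun P _ => ?_
  simp only [ofPred_forall]
  refine isClosed_iInter fun i => ?_
  exact isClosed_Icc.preimage (f := fun x : Fin 2 → ℝ => (q : ℝ) * x i - (P i : ℕ)) (by fun_prop)

lemma mem_ratNeighborhood_of_ne_zero {τ : Fin 2 → ℝ} {S : Finset ℕ} (hS : ∀ q ∈ S, 0 < q)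
    {x : Fin 2 → ℝ} (h : ratDensity τ S x ≠ 0) : x ∈ ratNeighborhood τ S := by
  obtain ⟨q, hq, h1⟩ := Finset.exists_ne_zero_of_sum_ne_zero (right_ne_zero_of_mul h)
  have h2 : ∀ i, ∃ p ∈ Finset.Ioo 0 q, bumpAt (τ i) q p (x i) ≠ 0 := fun i =>
    Finset.exists_ne_zero_of_sum_ne_zero (Finset.prod_ne_zero_iff.1 h1 i (Finset.mem_univ i))
  choose P hP hP' using h2
  simp only [ratNeighborhood, mem_iUnion]
  exact ⟨q, hq, P, Fintype.mem_piFinset.2 hP, fun i => mem_of_bumpAt_ne_zero (hS q hq) (hP' i)⟩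

lemma exists_refined_density {τ : Fin 2 → ℝ} (hτ : ∀ i, 0 ≤ τ i) (hsum : 1 < τ 0 + τ 1) {s : ℝ}
    (hs : AdmissibleExponent τ s) {K : Set (Fin 2 → ℝ)} (hK : IsCompact K)
    (hKI : ∀ x ∈ K, ∀ i, x i ∈ Ioo (0 : ℝ) 1) {f : (Fin 2 → ℝ) → ℝ} (hf : IsDensityOn K f)
    {η : ℝ} (hη : 0 < η) (N : ℕ) :
    ∃ g, IsDensityOn K g ∧ Summable (energyTerm τ s g) ∧
      ∑' k, energyTerm τ s g k ≤ ∑' k, energyTerm τ s f k + η ∧ (∀ x, f x = 0 → g x = 0) ∧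
      ∃ M ≥ N, ∀ x, g x ≠ 0 → x ∈ ratNeighborhood τ (levelPrimes M) := by
  obtain ⟨D, hD⟩ := hf.bddAbove hK
  obtain ⟨b, hb, M₀, hM₀⟩ := exists_summable_energyTerm_bound hτ hsum hs (2 * D)
  have hlim : Filter.Tendsto (fun M => ∫ x, f x * ratDensity τ (levelPrimes M) x) Filter.atTop
      (nhds 1) := by
    rw [← hf.integral_eq_one]
    exact tendsto_integral_mul_ratDensity hτ hf.continuous hK hKI hf.mem_of_ne_zero
  set I : ℕ → ℝ := fun M => ∫ x, f x * ratDensity τ (levelPrimes M) x with hI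
  have hc : Filter.Tendsto (fun M => (I M)⁻¹) Filter.atTop (nhds 1) := by
    simpa using hlim.inv₀ one_ne_zero
  have hc2 : ∀ᶠ M in Filter.atTop, (I M)⁻¹ ≤ 2 ∧ 0 < (I M)⁻¹ :=
    (hc.eventually (eventually_le_nhds (by norm_num))).and
      (hc.eventually (eventually_gt_nhds (by norm_num)))
  have hbound : ∀ᶠ M in Filter.atTop, ∀ k,
      energyTerm τ s (fun x => (I M)⁻¹ * f x * ratDensity τ (levelPrimes M) x) k ≤ b k := by
    filter_upwards [hc2, Filter.eventually_ge_atTop M₀] with M hM hM' k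
    refine hM₀ M hM' (fun x => (I M)⁻¹ * f x) (fun x => mul_nonneg hM.2.le (hf.nonneg x))
      (fun x => ?_) k
    exact mul_le_mul hM.1 (hD x) (hf.nonneg x) (by norm_num)
  have hnn : ∀ᶠ M in Filter.atTop, ∀ k,
      0 ≤ energyTerm τ s (fun x => (I M)⁻¹ * f x * ratDensity τ (levelPrimes M) x) k := by
    filter_upwards [hc2] with M hM k
    exact energyTerm_nonneg τ s (fun x => mul_nonneg (mul_nonneg hM.2.le (hf.nonneg x))
      (ratDensity_nonneg _ _ _)) k
  have htan : Filter.Tendsto (fun M => ∑' k, energyTerm τ s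
      (fun x => (I M)⁻¹ * f x * ratDensity τ (levelPrimes M) x) k) Filter.atTop
      (nhds (∑' k, energyTerm τ s f k)) := by
    refine tendsto_tsum_of_dominated_convergence hb
      (fun k => tendsto_energyTerm hτ s hK hKI hf hc k) ?_
    filter_upwards [hbound, hnn] with M h1 h2 k
    rw [Real.norm_of_nonneg (h2 k)]
    exact h1 k
  obtain ⟨M, hM, hM1, hM2, hM3, hM4⟩ := ((htan.eventually (eventually_le_nhds
    (by linarith : ∑' k, energyTerm τ s f k < ∑' k, energyTerm τ s f k + η))).and
    (hbound.and (hnn.and (hc2.and (Filter.eventually_ge_atTop N))))).exists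
  refine ⟨_, ⟨?_, ?_, ?_, ?_⟩, Summable.of_nonneg_of_le hM2 hM1 hb, hM, ?_, M, hM4, ?_⟩
  · exact (continuous_const.mul hf.continuous).mul (ratDensity_continuous _ _)
  · exact fun x => mul_nonneg (mul_nonneg hM3.2.le (hf.nonneg x)) (ratDensity_nonneg _ _ _)
  · simp_rw [mul_assoc]
    rw [integral_const_mul]
    exact inv_mul_cancel₀ (inv_pos.1 hM3.2).ne'
  · exact fun x hx => hf.mem_of_ne_zero x (right_ne_zero_of_mul (left_ne_zero_of_mul hx))
  · intro x hx
    simp only [hx, mul_zero, zero_mul]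
  · intro x hx
    exact mem_ratNeighborhood_of_ne_zero (fun q hq => (prime_of_mem_levelPrimes hq).pos)
      (right_ne_zero_of_mul hx)

lemma exists_limit_measure {K : Set (Fin 2 → ℝ)} (hK : IsCompact K)
    {f : ℕ → (Fin 2 → ℝ) → ℝ} (hf : ∀ n, IsDensityOn K (f n)) :
    ∃ (μ : Measure (Fin 2 → ℝ)) (l : Filter ℕ), IsProbabilityMeasure μ ∧ l.NeBot ∧
      l ≤ Filter.atTop ∧ μ Kᶜ = 0 ∧ ∀ w : BoundedContinuousFunction (Fin 2 → ℝ) ℝ,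
        Filter.Tendsto (fun n => ∫ x, w x * f n x) l (nhds (∫ x, w x ∂μ)) := by
  have hint : ∀ n, Integrable (f n) := fun n => by
    by_contra h
    have := (hf n).integral_eq_one
    rw [integral_undef h] at this
    exact zero_ne_one this
  have hprob : ∀ n, IsProbabilityMeasure
      ((volume : Measure (Fin 2 → ℝ)).withDensity fun x => ENNReal.ofReal (f n x)) := fun n => by
    refine ⟨?_⟩
    rw [withDensity_apply _ MeasurableSet.univ, Measure.restrict_univ,
      ← ofReal_integral_eq_lintegral_ofReal (hint n) (ae_of_all _ (hf n).nonneg),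
      (hf n).integral_eq_one, ENNReal.ofReal_one]
  let ν : ℕ → ProbabilityMeasure (Fin 2 → ℝ) := fun n => ⟨_, hprob n⟩
  have hνint : ∀ n (w : (Fin 2 → ℝ) → ℝ), ∫ x, w x ∂(ν n : Measure (Fin 2 → ℝ)) =
      ∫ x, w x * f n x := by
    intro n w
    change ∫ x, w x ∂(volume.withDensity fun x => ENNReal.ofReal (f n x)) = _
    rw [integral_withDensity_eq_integral_toReal_smul
      (hf n).continuous.measurable.ennreal_ofReal (ae_of_all _ fun _ => ENNReal.ofReal_lt_top)]
    refine integral_congr_ae (ae_of_all _ fun x => ?_)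
    simp only [ENNReal.toReal_ofReal ((hf n).nonneg x), smul_eq_mul, mul_comm]
  have hcpt := isCompact_setOfPred_probabilityMeasure_mass_eq_compl_isCompact_le
    (E := Fin 2 → ℝ) (u := fun _ => 0) (K := fun _ => K) tendsto_const_nhds (fun _ => hK)
    (Or.inl inferInstance)
  have hmem : ∀ n, ν n ∈ {μ : ProbabilityMeasure (Fin 2 → ℝ) | ∀ _ : ℕ, μ Kᶜ ≤ 0} := by
    intro n _
    refine le_of_eq ?_
    rw [ProbabilityMeasure.null_iff_toMeasure_null]
    change (volume.withDensity fun x => ENNReal.ofReal (f n x)) Kᶜ = 0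
    rw [withDensity_apply _ hK.measurableSet.compl]
    refine setLIntegral_eq_zero hK.measurableSet.compl fun x hx => ?_
    by_contra h
    refine hx ((hf n).mem_of_ne_zero x fun h0 => h ?_)
    simp [h0]
  obtain ⟨μ, hμ, hlim⟩ := hcpt.ultrafilter_le_nhds' ((Filter.hyperfilter ℕ).map ν)
    (Filter.mem_map.2 (Filter.Eventually.of_forall hmem))
  refine ⟨μ, Filter.hyperfilter ℕ, inferInstance, inferInstance, Nat.hyperfilter_le_atTop,
    ?_, fun w => ?_⟩
  · rw [← ProbabilityMeasure.null_iff_toMeasure_null]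
    exact le_antisymm (hμ 0) zero_le
  · have h := ProbabilityMeasure.tendsto_iff_forall_integral_tendsto.1
      (show Filter.Tendsto ν (Filter.hyperfilter ℕ) (nhds μ) from hlim) w
    simpa only [hνint] using h

lemma measure_compl_eq_zero_of_tendsto {K : Set (Fin 2 → ℝ)}
    {f : ℕ → (Fin 2 → ℝ) → ℝ} (hf : ∀ n, IsDensityOn K (f n)) {μ : Measure (Fin 2 → ℝ)}
    [IsFiniteMeasure μ] {l : Filter ℕ} [l.NeBot]
    (h : ∀ w : BoundedContinuousFunction (Fin 2 → ℝ) ℝ,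
      Filter.Tendsto (fun n => ∫ x, w x * f n x) l (nhds (∫ x, w x ∂μ)))
    {E : Set (Fin 2 → ℝ)} (hE : IsClosed E) (hfE : ∀ᶠ n in l, ∀ x, f n x ≠ 0 → x ∈ E) :
    μ Eᶜ = 0 := by
  have hne : E.Nonempty := by
    obtain ⟨n, hn⟩ := hfE.exists
    by_contra hc
    have h0 : ∀ x, f n x = 0 := fun x => by
      by_contra h1
      exact hc ⟨x, hn x h1⟩
    have := (hf n).integral_eq_one
    simp [h0] at this
  let w : BoundedContinuousFunction (Fin 2 → ℝ) ℝ :=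
    BoundedContinuousFunction.ofNormedAddCommGroup (fun x => min 1 (Metric.infDist x E))
      (continuous_const.min (Metric.continuous_infDist_pt E)) 1 fun x => by
        rw [Real.norm_of_nonneg (le_min zero_le_one Metric.infDist_nonneg)]
        exact min_le_left _ _
  have hw : ∀ x, w x = min 1 (Metric.infDist x E) := fun x => rfl
  have h0 : ∫ x, w x ∂μ = 0 := by
    refine tendsto_nhds_unique (h w) (tendsto_const_nhds.congr' ?_)
    filter_upwards [hfE] with n hn
    have : ∀ x, w x * f n x = 0 := fun x => by
      by_cases hx : f n x = 0
      · rw [hx, mul_zero]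
      · rw [hw, Metric.infDist_zero_of_mem (hn x hx), min_eq_right zero_le_one, zero_mul]
    simp [this]
  have hw0 : 0 ≤ fun x => w x := fun x => le_min zero_le_one Metric.infDist_nonneg
  rw [integral_eq_zero_iff_of_nonneg hw0 (w.integrable μ)] at h0
  refine measure_mono_null (fun x hx => ?_) (ae_iff.1 h0)
  have h1 := (hE.notMem_iff_infDist_pos hne).1 hx
  exact (lt_min zero_lt_one h1).ne'

lemma exists_density_sequence {τ : Fin 2 → ℝ} (hτ : ∀ i, 0 ≤ τ i) (hsum : 1 < τ 0 + τ 1) {s : ℝ}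
    (hs : AdmissibleExponent τ s) {K : Set (Fin 2 → ℝ)} (hK : IsCompact K)
    (hKI : ∀ x ∈ K, ∀ i, x i ∈ Ioo (0 : ℝ) 1) {f₀ : (Fin 2 → ℝ) → ℝ} (hf₀ : IsDensityOn K f₀) :
    ∃ f : ℕ → (Fin 2 → ℝ) → ℝ, (∀ n, IsDensityOn K (f n)) ∧
      (∃ W, ∀ m n, ∑ k ∈ Finset.range n, energyTerm τ s (f m) k ≤ W) ∧
      ∀ n, ∃ M ≥ n, ∀ m ≥ n, ∀ x, f m x ≠ 0 → x ∈ ratNeighborhood τ (levelPrimes M) := by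
  have step : ∀ (n : ℕ) (f : {f // IsDensityOn K f}), ∃ g : {f // IsDensityOn K f},
      Summable (energyTerm τ s g.1) ∧
      ∑' k, energyTerm τ s g.1 k ≤ ∑' k, energyTerm τ s f.1 k + (1 / 2) ^ n ∧
      (∀ x, f.1 x = 0 → g.1 x = 0) ∧
      ∃ M ≥ n, ∀ x, g.1 x ≠ 0 → x ∈ ratNeighborhood τ (levelPrimes M) := fun n f => by
    obtain ⟨g, h1, h2⟩ := exists_refined_density hτ hsum hs hK hKI f.2
      (η := (1 / 2) ^ n) (by positivity) n
    exact ⟨⟨g, h1⟩, h2⟩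
  choose F hF1 hF2 hF3 hF4 using step
  let f : ℕ → {f // IsDensityOn K f} := fun n => Nat.rec ⟨f₀, hf₀⟩ F n
  have hsucc : ∀ n, f (n + 1) = F n (f n) := fun n => rfl
  have hzero : ∀ m n, n ≤ m → ∀ x, (f n).1 x = 0 → (f m).1 x = 0 := by
    intro m n hnm x hx
    induction m, hnm using Nat.le_induction with
    | base => exact hx
    | succ m _ ih => rw [hsucc]; exact hF3 m _ x ih
  have hW : ∀ n, ∑' k, energyTerm τ s (f n).1 k ≤
      ∑' k, energyTerm τ s f₀ k + ∑ i ∈ Finset.range n, (1 / 2 : ℝ) ^ i := by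
    intro n
    induction n with
    | zero => simp [f]
    | succ n ih =>
      rw [Finset.sum_range_succ, hsucc]
      linarith [hF2 n (f n)]
  refine ⟨fun n => (f (n + 1)).1, fun n => (f (n + 1)).2,
    ⟨∑' k, energyTerm τ s f₀ k + 2, fun m n => ?_⟩, fun n => ?_⟩
  · refine (Summable.sum_le_tsum _ (fun k _ => energyTerm_nonneg τ s (f (m + 1)).2.nonneg k)
      (hF1 m (f m))).trans ((hW (m + 1)).trans ?_)
    gcongr
    exact sum_geometric_two_le _
  · obtain ⟨M, hM, h⟩ := hF4 n (f n)
    refine ⟨M, hM, fun m hm x hx => h x fun h0 => hx ?_⟩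
    exact hzero (m + 1) (n + 1) (by omega) x h0

/-- The measure `μ` has finite `s`-energy and gives little mass to the neighbourhoods of rational
points with small constant. -/
lemma exists_measure_energy_le {τ : Fin 2 → ℝ} (hτ : ∀ i, 0 ≤ τ i) (hsum : 1 < τ 0 + τ 1) {s : ℝ}
    (hs : AdmissibleExponent τ s) {K : Set (Fin 2 → ℝ)} (hK : IsCompact K)
    (hKI : ∀ x ∈ K, ∀ i, x i ∈ Ioo (0 : ℝ) 1) {f₀ : (Fin 2 → ℝ) → ℝ} (hf₀ : IsDensityOn K f₀) :
    ∃ μ : Measure (Fin 2 → ℝ), IsProbabilityMeasure μ ∧ μ Kᶜ = 0 ∧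
      (∀ n, ∃ M ≥ n, μ (ratNeighborhood τ (levelPrimes M))ᶜ = 0) ∧
      ∃ W : ℝ, ∀ n, ∑ k ∈ Finset.range n, ((∫ x, nearWeight τ (k + 1) x ∂μ) +
        ((2 : ℝ) ^ k) ^ s * ∑ α ∈ cellIndex k, (∫ x, cellWeight (2 ^ k) α x ∂μ) ^ 2) ≤ W := by
  obtain ⟨f, hf, ⟨W, hW⟩, hfn⟩ := exists_density_sequence hτ hsum hs hK hKI hf₀
  obtain ⟨μ, l, hμ, hl, hlt, hμK, hlim⟩ := exists_limit_measure hK hf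
  have hlim' : ∀ w : (Fin 2 → ℝ) → ℝ, Continuous w → (∀ x, 0 ≤ w x) → (∀ x, w x ≤ 1) →
      Filter.Tendsto (fun n => ∫ x, w x * f n x) l (nhds (∫ x, w x ∂μ)) := fun w h0 h1 h2 =>
    hlim (BoundedContinuousFunction.ofNormedAddCommGroup w h0 1 fun x => by
      rw [Real.norm_of_nonneg (h1 x)]; exact h2 x)
  refine ⟨μ, hμ, hμK, fun n => ?_, W, fun n => ?_⟩
  · obtain ⟨M, hM, h⟩ := hfn n
    exact ⟨M, hM, measure_compl_eq_zero_of_tendsto hf hlim (isClosed_ratNeighborhood _ _)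
      (hlt ((Filter.eventually_ge_atTop n).mono h))⟩
  · refine le_of_tendsto (tendsto_finsetSum _ fun k _ => (hlim' _ (nearWeight_continuous τ (k + 1))
      (nearWeight_nonneg _ _) (nearWeight_le_one _ _)).add ((tendsto_finsetSum _ fun α _ =>
        (hlim' _ (cellWeight_continuous _ α) (cellWeight_nonneg _ _)
          (cellWeight_le_one _ _)).pow 2).const_mul _)) (Filter.Eventually.of_forall fun m => hW m n)

lemma exists_isDensityOn_closedBall (x : Fin 2 → ℝ) {r : ℝ} (hr : 0 < r) :
    ∃ f, IsDensityOn (Metric.closedBall x r) f := by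
  let g : (Fin 2 → ℝ) → ℝ := fun y => max 0 (r - dist y x)
  have hgc : Continuous g := by fun_prop
  have hg0 : ∀ y, 0 ≤ g y := fun y => le_max_left _ _
  have hgs : ∀ y, g y ≠ 0 → y ∈ Metric.closedBall x r := fun y hy => by
    by_contra hc
    rw [Metric.mem_closedBall, not_le] at hc
    exact hy (max_eq_left (by linarith))
  have hcs : HasCompactSupport g := HasCompactSupport.intro (isCompact_closedBall x r) fun y hy => by
    by_contra h
    exact hy (hgs y h)
  have hpos : 0 < ∫ y, g y := hgc.integral_pos_of_hasCompactSupport_nonneg_nonzero hcs hg0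
    (x := x) (by simp [g, hr.ne', hr.le])
  refine ⟨fun y => (∫ y, g y)⁻¹ * g y, continuous_const.mul hgc,
    fun y => mul_nonneg (inv_nonneg.2 hpos.le) (hg0 y), ?_,
    fun y hy => hgs y (right_ne_zero_of_mul hy)⟩
  rw [integral_const_mul, inv_mul_cancel₀ hpos.ne']

lemma lintegral_tsum_ofReal_le {X : Type*} [MeasurableSpace X] {μ : Measure X} {g : ℕ → X → ℝ}
    (hgm : ∀ k, Measurable (g k)) (hg : ∀ k, Integrable (g k) μ) (hg0 : ∀ k x, 0 ≤ g k x) {W : ℝ}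
    (hW : ∀ n, ∑ k ∈ Finset.range n, ∫ x, g k x ∂μ ≤ W) :
    ∫⁻ x, ∑' k, ENNReal.ofReal (g k x) ∂μ ≤ ENNReal.ofReal W := by
  rw [lintegral_tsum fun k => (hgm k).ennreal_ofReal.aemeasurable]
  refine ENNReal.tsum_le_of_sum_range_le fun n => ?_
  calc _ = ∑ k ∈ Finset.range n, ENNReal.ofReal (∫ x, g k x ∂μ) :=
        Finset.sum_congr rfl fun k _ =>
          (ofReal_integral_eq_lintegral_ofReal (hg k) (ae_of_all _ (hg0 k))).symm
    _ = ENNReal.ofReal (∑ k ∈ Finset.range n, ∫ x, g k x ∂μ) :=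
        (ENNReal.ofReal_sum_of_nonneg fun k _ => integral_nonneg (hg0 k)).symm
    _ ≤ _ := ENNReal.ofReal_le_ofReal (hW n)

lemma integrable_cellWeight (μ : Measure (Fin 2 → ℝ)) [IsFiniteMeasure μ] (R : ℝ) (α : Fin 2 → ℤ) :
    Integrable (cellWeight R α) μ :=
  Integrable.of_bound (cellWeight_continuous R α).aestronglyMeasurable 1 (ae_of_all _ fun x => by
    rw [Real.norm_of_nonneg (cellWeight_nonneg R α x)]
    exact cellWeight_le_one R α x)

lemma integrable_nearWeight (μ : Measure (Fin 2 → ℝ)) [IsFiniteMeasure μ] (τ : Fin 2 → ℝ) (q : ℕ) :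
    Integrable (nearWeight τ q) μ :=
  Integrable.of_bound (nearWeight_continuous τ q).aestronglyMeasurable 1 (ae_of_all _ fun x => by
    rw [Real.norm_of_nonneg (nearWeight_nonneg τ q x)]
    exact nearWeight_le_one τ q x)

/-- The contribution of the scale `2⁻ᵏ` to the `s`-potential of `μ` at `x`. -/
def cellPotential (μ : Measure (Fin 2 → ℝ)) (s : ℝ) (k : ℕ) (x : Fin 2 → ℝ) : ℝ :=
  ((2 : ℝ) ^ k) ^ s * ∑ α ∈ cellIndex k, cellWeight (2 ^ k) α x * ∫ y, cellWeight (2 ^ k) α y ∂μ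

lemma cellPotential_continuous (μ : Measure (Fin 2 → ℝ)) (s : ℝ) (k : ℕ) :
    Continuous (cellPotential μ s k) :=
  continuous_const.mul (continuous_finsetSum _ fun α _ =>
    (cellWeight_continuous _ α).mul continuous_const)

lemma cellPotential_nonneg (μ : Measure (Fin 2 → ℝ)) (s : ℝ) (k : ℕ) (x : Fin 2 → ℝ) :
    0 ≤ cellPotential μ s k x :=
  mul_nonneg (by positivity) (Finset.sum_nonneg fun α _ => mul_nonneg (cellWeight_nonneg _ _ _)
    (integral_nonneg fun y => cellWeight_nonneg _ _ _))

lemma integral_cellPotential (μ : Measure (Fin 2 → ℝ)) [IsFiniteMeasure μ] (s : ℝ) (k : ℕ) :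
    Integrable (cellPotential μ s k) μ ∧ ∫ x, cellPotential μ s k x ∂μ =
      ((2 : ℝ) ^ k) ^ s * ∑ α ∈ cellIndex k, (∫ x, cellWeight (2 ^ k) α x ∂μ) ^ 2 := by
  have h : ∀ α ∈ cellIndex k, Integrable
      (fun x => cellWeight (2 ^ k) α x * ∫ y, cellWeight (2 ^ k) α y ∂μ) μ :=
    fun α _ => (integrable_cellWeight μ _ α).mul_const _
  refine ⟨(integrable_finsetSum _ h).const_mul _, ?_⟩
  unfold cellPotential
  rw [integral_const_mul, integral_finsetSum _ h]
  simp_rw [integral_mul_const, ← sq]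

lemma round_mem_cellIndex {x : Fin 2 → ℝ} (hx : ∀ i, x i ∈ Icc (0 : ℝ) 1) (j : ℕ) :
    (fun i => round ((2 : ℝ) ^ j * x i)) ∈ cellIndex j := by
  refine Fintype.mem_piFinset.2 fun i => ?_
  have h1 := abs_le.1 (abs_sub_round ((2 : ℝ) ^ j * x i))
  have h2 : (0 : ℝ) ≤ 2 ^ j * x i := mul_nonneg (by positivity) (hx i).1
  have h3 : (2 : ℝ) ^ j * x i ≤ 2 ^ j := mul_le_of_le_one_right (by positivity) (hx i).2
  rw [Finset.mem_Icc]
  constructor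
  · have : ((-1 : ℤ) : ℝ) ≤ round ((2 : ℝ) ^ j * x i) := by push_cast; linarith
    exact_mod_cast this
  · have : (round ((2 : ℝ) ^ j * x i) : ℝ) ≤ ((2 ^ j + 1 : ℤ) : ℝ) := by push_cast; linarith
    exact_mod_cast this

lemma measureReal_le_of_cellPotential_le {μ : Measure (Fin 2 → ℝ)} [IsFiniteMeasure μ] {s N : ℝ}
    {j : ℕ} {t : Set (Fin 2 → ℝ)} {x : Fin 2 → ℝ} (hx : ∀ i, x i ∈ Icc (0 : ℝ) 1)
    (hxN : cellPotential μ s j x ≤ N) (ht : ∀ y ∈ t, dist y x ≤ 1 / 2 * (1 / 2) ^ j) :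
    μ.real t ≤ N * ((1 / 2 : ℝ) ^ j) ^ s := by
  have h2 : (0 : ℝ) < 2 ^ j := by positivity
  set α : Fin 2 → ℤ := fun i => round ((2 : ℝ) ^ j * x i) with hα
  have hone : ∀ y, dist y x ≤ 1 / 2 * (1 / 2) ^ j → cellWeight (2 ^ j) α y = 1 := by
    intro y hy
    refine Finset.prod_eq_one fun i _ => gridCutoff_eq_one ?_
    have h3 : |y i - x i| ≤ 1 / 2 * (1 / 2) ^ j := (dist_le_pi_dist y x i).trans hy
    have h4 : |(2 : ℝ) ^ j * (y i - x i)| ≤ 1 / 2 := by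
      rw [abs_mul, abs_of_pos h2]
      calc (2 : ℝ) ^ j * |y i - x i| ≤ 2 ^ j * (1 / 2 * (1 / 2) ^ j) := by gcongr
        _ = 1 / 2 * (2 * (1 / 2)) ^ j := by rw [mul_pow]; ring
        _ = 1 / 2 := by norm_num
    have h5 := abs_sub_round ((2 : ℝ) ^ j * x i)
    calc |(2 : ℝ) ^ j * y i - α i|
        = |(2 : ℝ) ^ j * (y i - x i) + ((2 : ℝ) ^ j * x i - α i)| := by congr 1; ring
      _ ≤ _ := (abs_add_le _ _).trans (by linarith)
  have h6 : μ.real t ≤ ∫ y, cellWeight (2 ^ j) α y ∂μ := by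
    refine le_trans ?_ ((one_mul _).symm.le.trans (mul_meas_ge_le_integral_of_nonneg
      (ae_of_all _ (cellWeight_nonneg (2 ^ j) α)) (integrable_cellWeight μ _ α) 1))
    exact measureReal_mono fun y hy => (hone y (ht y hy)).ge
  have h7 : ((2 : ℝ) ^ j) ^ s * ∫ y, cellWeight (2 ^ j) α y ∂μ ≤ cellPotential μ s j x := by
    unfold cellPotential
    gcongr
    refine le_trans (le_of_eq ?_) (Finset.single_le_sum
      (f := fun α => cellWeight (2 ^ j) α x * ∫ y, cellWeight (2 ^ j) α y ∂μ)
      (fun β _ => mul_nonneg (cellWeight_nonneg _ _ _)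
        (integral_nonneg fun y => cellWeight_nonneg _ _ _)) (round_mem_cellIndex hx j))
    rw [hone x (by rw [dist_self]; positivity), one_mul]
  have h8 : ((1 / 2 : ℝ) ^ j) ^ s = (((2 : ℝ) ^ j) ^ s)⁻¹ := by
    rw [← Real.inv_rpow (by positivity), ← inv_pow, one_div]
  rw [h8, ← div_eq_mul_inv, le_div_iff₀ (by positivity), mul_comm]
  exact (mul_le_mul_of_nonneg_left h6 (by positivity)).trans (h7.trans hxN)

lemma measure_le_ediam_rpow {X : Type*} [PseudoEMetricSpace X] [MeasurableSpace X] {μ : Measure X}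
    {s : ℝ} (hs : 0 < s) {N : ℝ} (hN : 0 ≤ N) {t : Set X}
    (h : ∀ j : ℕ, Metric.ediam t ≤ ENNReal.ofReal (1 / 2 * (1 / 2) ^ j) →
      μ t ≤ ENNReal.ofReal (N * ((1 / 2 : ℝ) ^ j) ^ s))
    (ht : Metric.ediam t ≤ ENNReal.ofReal (1 / 2)) :
    μ t ≤ ENNReal.ofReal (N * 4 ^ s) * Metric.ediam t ^ s := by
  have hne : Metric.ediam t ≠ ⊤ := (ht.trans_lt ENNReal.ofReal_lt_top).ne
  lift Metric.ediam t to NNReal using hne with d hd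
  rcases eq_or_ne d 0 with h0 | h0
  · subst h0
    have h1 : Filter.Tendsto (fun j : ℕ => ENNReal.ofReal (N * ((1 / 2 : ℝ) ^ j) ^ s))
        Filter.atTop (nhds 0) := by
      have h2 : Filter.Tendsto (fun j : ℕ => N * ((1 / 2 : ℝ) ^ j) ^ s) Filter.atTop (nhds 0) := by
        have := ((tendsto_pow_atTop_nhds_zero_of_lt_one (r := (1 / 2 : ℝ)) (by norm_num)
          (by norm_num)).rpow_const (p := s) (Or.inr hs.le)).const_mul N
        rwa [Real.zero_rpow hs.ne', mul_zero] at this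
      simpa using ENNReal.tendsto_ofReal h2
    exact (ge_of_tendsto h1 (Filter.Eventually.of_forall fun j => h j (by simp))).trans zero_le
  · have hd0 : (0 : ℝ) < d := by positivity
    rw [← ENNReal.ofReal_coe_nnreal, ENNReal.ofReal_le_ofReal_iff (by norm_num)] at ht
    obtain ⟨j, hj1, hj2⟩ := exists_nat_pow_near_of_lt_one (x := 2 * (d : ℝ)) (y := 1 / 2)
      (by linarith) (by linarith) (by norm_num) (by norm_num)
    refine (h j ?_).trans ?_
    · rw [← ENNReal.ofReal_coe_nnreal]
      exact ENNReal.ofReal_le_ofReal (by linarith)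
    · rw [← ENNReal.ofReal_coe_nnreal, ENNReal.ofReal_rpow_of_pos hd0,
        ← ENNReal.ofReal_mul (by positivity), mul_assoc, ← Real.mul_rpow (by norm_num) hd0.le]
      refine ENNReal.ofReal_le_ofReal ?_
      gcongr
      rw [pow_succ] at hj1
      linarith

/-- A set of full measure for a measure of finite `s`-energy has dimension at least `s`. -/
lemma le_dimH_of_energy_le {μ : Measure (Fin 2 → ℝ)} [IsProbabilityMeasure μ] {s : NNReal}
    (hs : 0 < s) {W : ℝ}
    (hW : ∀ n, ∑ k ∈ Finset.range n,
      ((2 : ℝ) ^ k) ^ (s : ℝ) * ∑ α ∈ cellIndex k, (∫ x, cellWeight (2 ^ k) α x ∂μ) ^ 2 ≤ W)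
    {A : Set (Fin 2 → ℝ)} (hA : ∀ᵐ x ∂μ, x ∈ A) (hI : ∀ᵐ x ∂μ, ∀ i, x i ∈ Icc (0 : ℝ) 1) :
    (s : ENNReal) ≤ dimH A := by
  have hs' : (0 : ℝ) < s := by exact_mod_cast hs
  set h : (Fin 2 → ℝ) → ENNReal := fun x => ∑' k, ENNReal.ofReal (cellPotential μ s k x) with hh
  have hhm : Measurable h := Measurable.tsum fun k =>
    (cellPotential_continuous μ s k).measurable.ennreal_ofReal
  have hle : ∫⁻ x, h x ∂μ ≤ ENNReal.ofReal W := by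
    refine lintegral_tsum_ofReal_le (fun k => (cellPotential_continuous μ s k).measurable)
      (fun k => (integral_cellPotential μ s k).1) (fun k => cellPotential_nonneg μ s k) fun n => ?_
    simp_rw [fun k => (integral_cellPotential μ s k).2]
    exact hW n
  have hfin : ∀ᵐ x ∂μ, h x < ⊤ := ae_lt_top hhm (hle.trans_lt ENNReal.ofReal_lt_top).ne
  obtain ⟨N, hN⟩ : ∃ N : ℕ, μ {x | h x ≤ N} ≠ 0 := by
    by_contra! hc
    have h1 := ae_all_iff.2 fun N : ℕ => measure_eq_zero_iff_ae_notMem.1 (hc N)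
    obtain ⟨x, hx1, hx2⟩ := (h1.and hfin).exists
    obtain ⟨N, hN⟩ := ENNReal.exists_nat_gt hx2.ne
    exact hx1 N hN.le
  set F : Set (Fin 2 → ℝ) := {x | h x ≤ N} ∩ {x | ∀ i, x i ∈ Icc (0 : ℝ) 1} with hF
  have hFm : MeasurableSet F := (measurableSet_le hhm measurable_const).inter (by
    simp only [ofPred_forall]
    exact MeasurableSet.iInter fun i => measurableSet_Icc.preimage (measurable_pi_apply i))
  have hFA : μ.restrict F A ≠ 0 := by
    have h1 : μ.restrict F Aᶜ = 0 :=
      nonpos_iff_eq_zero.1 ((Measure.restrict_apply_le F _).trans hA.le)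
    have h2 : μ.restrict F univ ≠ 0 := by
      rw [Measure.restrict_apply_univ]
      refine fun h3 => hN (measure_mono_null (fun x hx => ?_) (measure_union_null h3 hI))
      by_cases hx' : x ∈ {x : Fin 2 → ℝ | ∀ i, x i ∈ Icc (0 : ℝ) 1}
      · exact Or.inl ⟨hx, hx'⟩
      · exact Or.inr hx'
    intro h3
    exact h2 (by rw [← union_compl_self A]; exact measure_union_null h3 h1)
  have hmass : ∀ t : Set (Fin 2 → ℝ), Metric.ediam t ≤ ENNReal.ofReal (1 / 2) →
      μ.restrict F t ≤ ENNReal.ofReal (N * 4 ^ (s : ℝ)) * Metric.ediam t ^ (s : ℝ) := by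
    intro t ht
    refine measure_le_ediam_rpow hs' N.cast_nonneg (fun j hj => ?_) ht
    rw [Measure.restrict_apply' hFm]
    rcases (t ∩ F).eq_empty_or_nonempty with he | ⟨x, hxt, hxF⟩
    · simp [he]
    rw [← ofReal_measureReal]
    refine ENNReal.ofReal_le_ofReal (measureReal_le_of_cellPotential_le hxF.2 ?_ fun y hy => ?_)
    · have := (ENNReal.le_tsum (f := fun k => ENNReal.ofReal (cellPotential μ s k x)) j).trans hxF.1
      rwa [← ENNReal.ofReal_natCast, ENNReal.ofReal_le_ofReal_iff N.cast_nonneg] at this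
    · have := (Metric.edist_le_ediam_of_mem hy.1 hxt).trans hj
      rwa [edist_dist, ENNReal.ofReal_le_ofReal_iff (by positivity)] at this
  set C := ENNReal.ofReal (N * 4 ^ (s : ℝ)) + 1 with hC
  have hC0 : C ≠ 0 := by simp [hC]
  have hCt : C ≠ ⊤ := ENNReal.add_ne_top.2 ⟨ENNReal.ofReal_ne_top, ENNReal.one_ne_top⟩
  have hcomp := Measure.le_hausdorffMeasure (X := Fin 2 → ℝ) (s : ℝ) (C⁻¹ • μ.restrict F)
    (ENNReal.ofReal (1 / 2)) (by simp) fun t ht => by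
      rw [Measure.smul_apply, smul_eq_mul]
      calc C⁻¹ * μ.restrict F t ≤ C⁻¹ * (C * Metric.ediam t ^ (s : ℝ)) := by
            gcongr
            refine (hmass t ht).trans ?_
            gcongr
            exact le_self_add
        _ = _ := by rw [← mul_assoc, ENNReal.inv_mul_cancel hC0 hCt, one_mul]
  refine le_dimH_of_hausdorffMeasure_ne_zero fun h0 => ?_
  have h1 := (hcomp A).trans h0.le
  rw [Measure.smul_apply, smul_eq_mul, nonpos_iff_eq_zero, mul_eq_zero] at h1
  exact h1.elim (ENNReal.inv_ne_zero.2 hCt) hFA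

lemma mem_approxSet_of_frequently {τ : Fin 2 → ℝ} {x : Fin 2 → ℝ}
    (hx : ∀ i, x i ∈ Icc (0 : ℝ) 1)
    (h : ∀ n, ∃ M ≥ n, x ∈ ratNeighborhood τ (levelPrimes M)) :
    x ∈ approxSet 2 (psiTau 2 τ) := by
  refine ⟨hx, infinite_of_not_bddAbove ?_⟩
  rintro ⟨n, hn⟩
  obtain ⟨M, hM, h1⟩ := h n
  simp only [ratNeighborhood, mem_iUnion] at h1
  obtain ⟨q, hq, P, -, h2⟩ := h1
  have h3 := lt_of_mem_levelPrimes hq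
  have hq0 : (0 : ℝ) < q := by exact_mod_cast (Nat.zero_le M).trans_lt h3
  refine absurd (hn (a := q) ⟨by omega, fun i => (P i : ℤ), fun i => ?_⟩) (by omega)
  have h4 := h2 i
  have h5 : 0 < (q : ℝ) ^ (-(τ i)) := by positivity
  rw [psiTau, Int.cast_natCast, abs_of_nonneg (by linarith [h4.1])]
  linarith [h4.2]

lemma notMem_approxSet_of_tsum_ne_top {τ : Fin 2 → ℝ} {x : Fin 2 → ℝ}
    (h : ∑' k, ENNReal.ofReal (nearWeight τ (k + 1) x) ≠ ⊤) :
    x ∉ approxSet 2 (fun q i => 1 / 8 * psiTau 2 τ q i) := by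
  rintro ⟨-, hinf⟩
  have hfin := ENNReal.finite_const_le_of_tsum_ne_top h one_ne_zero
  refine hinf ((hfin.image (· + 1)).subset ?_)
  rintro q ⟨hq, p, hp⟩
  refine ⟨q - 1, ?_, by simp only; omega⟩
  have h1 : nearWeight τ q x = 1 :=
    Finset.prod_eq_one fun i _ => nearCutoff_eq_one hq (hp i).le
  rw [mem_ofPred_eq, Nat.sub_add_cancel hq, h1, ENNReal.ofReal_one]

lemma coe_le_dimH_inter_badSet {τ : Fin 2 → ℝ} (hτ : ∀ i, 0 ≤ τ i) (hsum : 1 < τ 0 + τ 1)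
    {s : NNReal} (hs : 0 < s) (hadm : AdmissibleExponent τ s) {x : Fin 2 → ℝ} {r : ℝ} (hr : 0 < r)
    (hB : Metric.closedBall x r ⊆ {y : Fin 2 → ℝ | ∀ i, y i ∈ Icc (0 : ℝ) 1}) :
    (s : ENNReal) ≤ dimH (Metric.closedBall x r ∩ badSet 2 (psiTau 2 τ)) := by
  obtain ⟨f₀, hf₀⟩ := exists_isDensityOn_closedBall x (half_pos hr)
  have hKI : ∀ y ∈ Metric.closedBall x (r / 2), ∀ i, y i ∈ Ioo (0 : ℝ) 1 := by
    intro y hy i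
    have h1 : ∀ c : ℝ, |c| ≤ r / 2 → y i + c ∈ Icc (0 : ℝ) 1 := by
      intro c hc
      refine hB (a := fun i => y i + c) ?_ i
      rw [Metric.mem_closedBall] at hy ⊢
      refine (dist_pi_le_iff hr.le).2 fun k => ?_
      have h2 := (dist_le_pi_dist y x k).trans hy
      rw [Real.dist_eq] at h2 ⊢
      calc |y k + c - x k| = |(y k - x k) + c| := by congr 1; ring
        _ ≤ _ := (abs_add_le _ _).trans (by linarith)
    have h2 := (h1 (-(r / 2)) (by rw [abs_neg, abs_of_pos (half_pos hr)])).1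
    have h3 := (h1 (r / 2) (by rw [abs_of_pos (half_pos hr)])).2
    constructor <;> linarith
  obtain ⟨μ, hμ, hμK, hμN, W, hW⟩ := exists_measure_energy_le hτ hsum hadm
    (isCompact_closedBall x (r / 2)) hKI hf₀
  have hnear0 : ∀ k, 0 ≤ ∫ x, nearWeight τ (k + 1) x ∂μ := fun k =>
    integral_nonneg fun x => nearWeight_nonneg _ _ _
  have haeK : ∀ᵐ y ∂μ, y ∈ Metric.closedBall x (r / 2) := hμK
  have haeN : ∀ᵐ y ∂μ, ∀ n, ∃ M ≥ n, y ∈ ratNeighborhood τ (levelPrimes M) := by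
    refine ae_all_iff.2 fun n => ?_
    obtain ⟨M, hM, h⟩ := hμN n
    have h' : ∀ᵐ y ∂μ, y ∈ ratNeighborhood τ (levelPrimes M) := h
    exact h'.mono fun y hy => ⟨M, hM, hy⟩
  have haeS : ∀ᵐ y ∂μ, ∑' k, ENNReal.ofReal (nearWeight τ (k + 1) y) < ⊤ := by
    refine ae_lt_top (Measurable.tsum fun k =>
      (nearWeight_continuous τ (k + 1)).measurable.ennreal_ofReal) (ne_top_of_le_ne_top
        (ENNReal.ofReal_ne_top (r := W)) (lintegral_tsum_ofReal_le
          (fun k => (nearWeight_continuous τ (k + 1)).measurable)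
          (fun k => integrable_nearWeight μ τ (k + 1)) (fun k => nearWeight_nonneg τ (k + 1))
          fun n => (Finset.sum_le_sum fun k _ => ?_).trans (hW n)))
    exact le_add_of_nonneg_right (mul_nonneg (by positivity)
      (Finset.sum_nonneg fun α _ => sq_nonneg _))
  refine le_dimH_of_energy_le (μ := μ) hs (W := W) (fun n =>
    (Finset.sum_le_sum fun k _ => le_add_of_nonneg_left (hnear0 k)).trans (hW n)) ?_ ?_
  · filter_upwards [haeK, haeN, haeS] with y h1 h2 h3
    refine ⟨Metric.closedBall_subset_closedBall (by linarith) h1,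
      mem_approxSet_of_frequently (fun i => Ioo_subset_Icc_self (hKI y h1 i)) h2, fun h4 => ?_⟩
    exact notMem_approxSet_of_tsum_ne_top h3.ne (mem_iInter₂.1 h4 (1 / 8) (by norm_num))
  · filter_upwards [haeK] with y h1 i using Ioo_subset_Icc_self (hKI y h1 i)

lemma admissibleExponent_of_lt {τ1 τ2 : ℝ} (hτ2 : 0 ≤ τ2) (hτ : τ2 ≤ τ1)
    (hsum : 1 < τ1 + τ2) {s : ℝ} (hs0 : 0 ≤ s)
    (hs : s < min ((3 + τ1 - τ2) / (1 + τ1)) (3 / (1 + τ2))) :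
    AdmissibleExponent ![τ1, τ2] s := by
  obtain ⟨s', hss', hs'⟩ := exists_between hs
  obtain ⟨h1, h2⟩ := lt_min_iff.1 hs'
  rw [lt_div_iff₀ (by linarith)] at h1 h2
  have h3 : s' < 2 := by nlinarith
  rcases le_total s' 1 with h | h
  · refine ⟨![0, s'], min 1 (3 - s' * (1 + τ2)), lt_min one_pos (by linarith), min_le_left _ _,
      ?_, ?_, by simpa using hss', ?_⟩
    · simpa [Fin.forall_fin_two] using hs0.trans hss'.le
    · simpa [Fin.forall_fin_two] using h
    · simpa using by linarith [min_le_right 1 (3 - s' * (1 + τ2))]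
  · set ε := min 1 (3 - ((s' - 1) * (1 + τ1) + (1 + τ2))) with hε
    have hε' : ε ≤ 3 - ((s' - 1) * (1 + τ1) + (1 + τ2)) := min_le_right _ _
    refine ⟨![s' - 1, 1], ε, lt_min one_pos (by linarith), min_le_left _ _,
      ?_, ?_, by simpa using hss', ?_⟩
    · simpa [Fin.forall_fin_two] using h
    · simpa [Fin.forall_fin_two] using by linarith
    · simp
      linarith

/-- The lower bound for the dimension of the badly approximable points in a ball. -/
lemma le_dimH_inter_badSet {τ1 τ2 : ℝ} (hτ : τ2 ≤ τ1) (hτ2 : 0 ≤ τ2) (hsum : 1 < τ1 + τ2)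
    {x : Fin 2 → ℝ} {r : ℝ} (hr : 0 < r)
    (hB : Metric.closedBall x r ⊆ {y : Fin 2 → ℝ | ∀ i, y i ∈ Icc (0 : ℝ) 1}) :
    ENNReal.ofReal (min ((3 + τ1 - τ2) / (1 + τ1)) (3 / (1 + τ2))) ≤
      dimH (Metric.closedBall x r ∩ badSet 2 (psiTau 2 ![τ1, τ2])) := by
  refine le_of_forall_lt fun c hc => ?_
  obtain ⟨s, hcs, hs⟩ := ENNReal.lt_iff_exists_nnreal_btwn.1 hc
  refine hcs.trans_le ?_
  have hs0 : 0 < s := by exact_mod_cast (zero_le (a := c)).trans_lt hcs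
  have hs1 : (s : ℝ) < min ((3 + τ1 - τ2) / (1 + τ1)) (3 / (1 + τ2)) := by
    rw [← ENNReal.ofReal_coe_nnreal] at hs
    exact lt_of_not_ge fun h => hs.not_ge (ENNReal.ofReal_le_ofReal h)
  exact coe_le_dimH_inter_badSet (by simp [Fin.forall_fin_two, hτ2, hτ2.trans hτ])
    (by simpa using hsum) hs0 (admissibleExponent_of_lt hτ2 hτ hsum s.2 hs1) hr hB

/-- Indices of the pieces of size `q ^ (-(1 + σ))` that cover the rectangles of denominator `q`. -/
def coverIndex (τ σ : ℝ) (q : ℕ) : Finset (ℤ × ℤ × ℤ) :=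
  Finset.Icc (-1) ((q : ℤ) + 1) ×ˢ Finset.Icc (-1) ((q : ℤ) + 1) ×ˢ
    Finset.Icc (-⌈(q : ℝ) ^ (σ - τ)⌉) ⌈(q : ℝ) ^ (σ - τ)⌉

/-- The pieces of size `q ^ (-(1 + σ))` that cover the rectangles of denominator `q`. -/
def coverPiece (σ : ℝ) (q : ℕ) (z : ℤ × ℤ × ℤ) : Set (Fin 2 → ℝ) :=
  Metric.closedBall ![z.1 / q, z.2.1 / q + z.2.2 * (q : ℝ) ^ (-(1 + σ))] ((q : ℝ) ^ (-(1 + σ)))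

lemma card_coverIndex_le {τ σ : ℝ} (h : τ ≤ σ) {q : ℕ} (hq : 0 < q) :
    ((coverIndex τ σ q).card : ℝ) ≤ 80 * (q : ℝ) ^ (2 + σ - τ) := by
  have hq1 : (1 : ℝ) ≤ q := by exact_mod_cast hq
  have he : 1 ≤ (q : ℝ) ^ (σ - τ) := Real.one_le_rpow hq1 (by linarith)
  have hK := Int.ceil_lt_add_one ((q : ℝ) ^ (σ - τ))
  have hK0 : 0 ≤ ⌈(q : ℝ) ^ (σ - τ)⌉ := Int.ceil_nonneg (by linarith)
  set K := ⌈(q : ℝ) ^ (σ - τ)⌉ with hKd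
  have h1 : ((Finset.Icc (-1) ((q : ℤ) + 1)).card : ℝ) ≤ 4 * q := by
    rw [Int.card_Icc]
    have : ((q : ℤ) + 1 + 1 - -1).toNat = q + 3 := by omega
    rw [this]
    push_cast
    linarith
  have h2 : ((Finset.Icc (-K) K).card : ℝ) ≤ 5 * (q : ℝ) ^ (σ - τ) := by
    rw [Int.card_Icc]
    have h3 : ((K + 1 - -K).toNat : ℤ) = 2 * K + 1 := by omega
    have h4 : ((K + 1 - -K).toNat : ℝ) = 2 * K + 1 := by exact_mod_cast h3
    rw [h4]
    linarith
  rw [coverIndex, Finset.card_product, Finset.card_product]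
  push_cast
  calc _ ≤ (4 * (q : ℝ)) * ((4 * q) * (5 * (q : ℝ) ^ (σ - τ))) := by gcongr
    _ = 80 * ((q : ℝ) ^ (2 : ℝ) * (q : ℝ) ^ (σ - τ)) := by rw [Real.rpow_two]; ring
    _ = _ := by rw [← Real.rpow_add (by linarith), add_sub_assoc]

lemma ediam_coverPiece_le (σ : ℝ) (q : ℕ) (z : ℤ × ℤ × ℤ) :
    Metric.ediam (coverPiece σ q z) ≤ ENNReal.ofReal (2 * (q : ℝ) ^ (-(1 + σ))) := by
  rw [coverPiece, ← Metric.closedEBall_ofReal (by positivity), ENNReal.ofReal_mul (by norm_num),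
    ENNReal.ofReal_ofNat]
  exact Metric.ediam_closedEBall_le

lemma mem_Icc_of_abs_sub_lt {q : ℕ} {t : ℝ} (ht : t ∈ Icc (0 : ℝ) 1) {p : ℤ}
    (h : |(q : ℝ) * t - p| < 1) : p ∈ Finset.Icc (-1 : ℤ) (q + 1) := by
  have h1 := abs_lt.1 h
  have h2 : (0 : ℝ) ≤ q * t := mul_nonneg (by positivity) ht.1
  have h3 : (q : ℝ) * t ≤ q := mul_le_of_le_one_right (by positivity) ht.2
  rw [Finset.mem_Icc]
  constructor
  · have : ((-1 : ℤ) : ℝ) ≤ p := by push_cast; linarith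
    exact_mod_cast this
  · have : (p : ℝ) ≤ ((q + 1 : ℤ) : ℝ) := by push_cast; linarith
    exact_mod_cast this

lemma exists_mem_coverPiece {τ1 τ2 σ : ℝ} (hτ2 : 0 ≤ τ2) (h2 : τ2 ≤ σ) (h1 : σ ≤ τ1)
    {q : ℕ} (hq : 0 < q) {x : Fin 2 → ℝ} (hx : ∀ i, x i ∈ Icc (0 : ℝ) 1) {p : Fin 2 → ℤ}
    (hp : ∀ i, |(q : ℝ) * x i - p i| < psiTau 2 ![τ1, τ2] q i) :
    ∃ z ∈ coverIndex τ2 σ q, x ∈ coverPiece σ q z := by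
  have hq0 : (0 : ℝ) < q := by exact_mod_cast hq
  have hq1 : (1 : ℝ) ≤ q := by exact_mod_cast hq
  have hp0 : |(q : ℝ) * x 0 - p 0| < (q : ℝ) ^ (-τ1) := hp 0
  have hp1 : |(q : ℝ) * x 1 - p 1| < (q : ℝ) ^ (-τ2) := hp 1
  have hone : ∀ t : ℝ, 0 ≤ t → (q : ℝ) ^ (-t) ≤ 1 := fun t ht =>
    Real.rpow_le_one_of_one_le_of_nonpos hq1 (by linarith)
  set ρ := (q : ℝ) ^ (-(1 + σ)) with hρ
  have hρ0 : 0 < ρ := by positivity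
  have hqρ : ∀ t : ℝ, (q : ℝ) ^ (-t) = (q : ℝ) ^ (σ - t) * (q * ρ) := fun t => by
    rw [hρ, show -t = (σ - t) + (1 + -(1 + σ)) by ring, Real.rpow_add hq0, Real.rpow_add hq0,
      Real.rpow_one]
  set u := (x 1 - p 1 / q) / ρ with hu
  have hxu : x 1 = p 1 / q + u * ρ := by rw [hu, div_mul_cancel₀ _ hρ0.ne']; ring
  have hu1 : |u| < (q : ℝ) ^ (σ - τ2) := by
    have h3 : (q : ℝ) * x 1 - p 1 = u * (q * ρ) := by
      rw [hxu]; field_simp; ring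
    rw [h3, hqρ, abs_mul, abs_of_pos (mul_pos hq0 hρ0)] at hp1
    exact lt_of_mul_lt_mul_right hp1 (by positivity)
  obtain ⟨hu2, hu3⟩ := abs_lt.1 hu1
  refine ⟨(p 0, p 1, ⌊u⌋), ?_, ?_⟩
  · refine Finset.mk_mem_product (mem_Icc_of_abs_sub_lt (hx 0) (hp0.trans_le (hone _ (by linarith))))
      (Finset.mk_mem_product (mem_Icc_of_abs_sub_lt (hx 1) (hp1.trans_le (hone _ hτ2)))
        (Finset.mem_Icc.2 ⟨?_, ?_⟩))
    · rw [Int.le_floor]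
      push_cast
      linarith [Int.le_ceil ((q : ℝ) ^ (σ - τ2))]
    · exact (Int.floor_le_floor hu3.le).trans (Int.floor_le_ceil _)
  · rw [coverPiece, Metric.mem_closedBall, dist_pi_le_iff hρ0.le, Fin.forall_fin_two]
    constructor
    · have h3 : x 0 - p 0 / q = (q * x 0 - p 0) / q := by field_simp
      simp only [Matrix.cons_val_zero, Real.dist_eq]
      rw [h3, abs_div, abs_of_pos hq0, div_le_iff₀ hq0]
      calc _ ≤ (q : ℝ) ^ (-τ1) := hp0.le
        _ ≤ (q : ℝ) ^ (-σ) := Real.rpow_le_rpow_of_exponent_le hq1 (by linarith)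
        _ = _ := by rw [hqρ, sub_self, Real.rpow_zero, one_mul, mul_comm]
    · simp only [Matrix.cons_val_one, Matrix.cons_val_fin_one, Real.dist_eq]
      have h3 : x 1 - (p 1 / q + ⌊u⌋ * ρ) = (u - ⌊u⌋) * ρ := by rw [hxu]; ring
      rw [h3, abs_mul, abs_of_pos hρ0, abs_of_nonneg (sub_nonneg.2 (Int.floor_le u))]
      exact mul_le_of_le_one_left hρ0.le (by linarith [Int.lt_floor_add_one u])

lemma sum_ediam_coverPiece_le {τ σ : ℝ} (h : τ ≤ σ) {d : ℝ} (hd : 0 ≤ d) {q : ℕ} (hq : 0 < q) :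
    ∑ z ∈ coverIndex τ σ q, Metric.ediam (coverPiece σ q z) ^ d ≤
      ENNReal.ofReal (80 * 2 ^ d * (q : ℝ) ^ (2 + σ - τ - d * (1 + σ))) := by
  have hq0 : (0 : ℝ) < q := by exact_mod_cast hq
  calc _ ≤ ∑ z ∈ coverIndex τ σ q, ENNReal.ofReal ((2 * (q : ℝ) ^ (-(1 + σ))) ^ d) := by
        refine Finset.sum_le_sum fun z _ => ?_
        rw [← ENNReal.ofReal_rpow_of_nonneg (by positivity) hd]
        exact ENNReal.rpow_le_rpow (ediam_coverPiece_le σ q z) hd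
    _ = ENNReal.ofReal ((coverIndex τ σ q).card * (2 * (q : ℝ) ^ (-(1 + σ))) ^ d) := by
        rw [Finset.sum_const, nsmul_eq_mul, ENNReal.ofReal_mul (by positivity),
          ENNReal.ofReal_natCast]
    _ ≤ _ := by
        refine ENNReal.ofReal_le_ofReal ?_
        calc _ ≤ 80 * (q : ℝ) ^ (2 + σ - τ) * (2 * (q : ℝ) ^ (-(1 + σ))) ^ d := by
              gcongr
              exact card_coverIndex_le h hq
          _ = 80 * 2 ^ d * ((q : ℝ) ^ (2 + σ - τ) * (q : ℝ) ^ (-(1 + σ) * d)) := by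
              rw [Real.mul_rpow (by norm_num) (by positivity), ← Real.rpow_mul hq0.le]
              ring
          _ = _ := by
              rw [← Real.rpow_add hq0]
              congr 2
              ring

lemma dimH_approxSet_le_coe {τ1 τ2 σ : ℝ} (hτ2 : 0 ≤ τ2) (h2 : τ2 ≤ σ) (h1 : σ ≤ τ1)
    {d : NNReal} (hd : (3 + σ - τ2) / (1 + σ) < d) :
    dimH (approxSet 2 (psiTau 2 ![τ1, τ2])) ≤ d := by
  have hσ : 0 < 1 + σ := by linarith
  rw [div_lt_iff₀ hσ] at hd
  set c : ℝ := 80 * 2 ^ (d : ℝ) with hc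
  set e : ℝ := 2 + σ - τ2 - d * (1 + σ) with he
  have hsumm : Summable fun q : ℕ => c * (q : ℝ) ^ e :=
    (Real.summable_nat_rpow.2 (by linarith)).mul_left c
  have hfin : ∑' q : ℕ, ENNReal.ofReal (c * (q : ℝ) ^ e) ≠ ⊤ := hsumm.tsum_ofReal_ne_top
  refine dimH_le_of_hausdorffMeasure_ne_top (ne_top_of_le_ne_top hfin ?_)
  refine (Measure.hausdorffMeasure_le_liminf_tsum
    (ι := fun n : ℕ => Σ m : ℕ, coverIndex τ2 σ (m + (n + 1))) (d : ℝ) _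
    (l := Filter.atTop) (fun n : ℕ => ENNReal.ofReal (2 * ((n + 1 : ℕ) : ℝ) ^ (-(1 + σ)))) ?_
    (fun n i => coverPiece σ (i.1 + (n + 1)) i.2) ?_ ?_).trans ?_
  · have h3 := ((tendsto_rpow_neg_atTop hσ).comp
      (tendsto_natCast_atTop_atTop.comp (Filter.tendsto_add_atTop_nat 1))).const_mul 2
    simpa using ENNReal.tendsto_ofReal h3
  · refine Filter.Eventually.of_forall fun n i => (ediam_coverPiece_le _ _ _).trans ?_
    refine ENNReal.ofReal_le_ofReal ?_
    gcongr 2 * ?_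
    exact Real.rpow_le_rpow_of_nonpos (by positivity) (by push_cast; linarith [i.1.cast_nonneg (α := ℝ)])
      (by linarith)
  · refine Filter.Eventually.of_forall fun n x hx => ?_
    obtain ⟨q, ⟨hq, p, hp⟩, hnq⟩ := hx.2.exists_gt n
    obtain ⟨z, hz, hxz⟩ := exists_mem_coverPiece hτ2 h2 h1 hq hx.1 hp
    obtain ⟨m, rfl⟩ : ∃ m, q = m + (n + 1) := ⟨q - (n + 1), by omega⟩
    exact mem_iUnion.2 ⟨⟨m, z, hz⟩, hxz⟩
  · refine Filter.liminf_le_of_frequently_le' (Filter.Frequently.of_forall fun n => ?_)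
    rw [ENNReal.tsum_sigma' (fun i : (Σ m : ℕ, coverIndex τ2 σ (m + (n + 1))) =>
      Metric.ediam (coverPiece σ (i.1 + (n + 1)) i.2) ^ (d : ℝ))]
    refine (ENNReal.tsum_le_tsum fun m => ?_).trans (ENNReal.tsum_comp_le_tsum_of_injective
      (f := fun m => m + (n + 1)) (add_left_injective _)
      fun q : ℕ => ENNReal.ofReal (c * (q : ℝ) ^ e))
    rw [Finset.tsum_subtype (coverIndex τ2 σ (m + (n + 1)))
      fun z => Metric.ediam (coverPiece σ (m + (n + 1)) z) ^ (d : ℝ)]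
    exact sum_ediam_coverPiece_le h2 d.2 (by omega)

/-- The upper bound for the dimension of the approximable points. -/
lemma dimH_approxSet_le {τ1 τ2 : ℝ} (hτ : τ2 ≤ τ1) (hτ2 : 0 ≤ τ2) :
    dimH (approxSet 2 (psiTau 2 ![τ1, τ2])) ≤
      ENNReal.ofReal (min ((3 + τ1 - τ2) / (1 + τ1)) (3 / (1 + τ2))) := by
  refine le_of_forall_gt fun c hc => ?_
  obtain ⟨d, hd, hdc⟩ := ENNReal.lt_iff_exists_nnreal_btwn.1 hc
  refine lt_of_le_of_lt ?_ hdc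
  have hd1 : min ((3 + τ1 - τ2) / (1 + τ1)) (3 / (1 + τ2)) < (d : ℝ) := by
    rw [← ENNReal.ofReal_coe_nnreal] at hd
    exact lt_of_not_ge fun h => hd.not_ge (ENNReal.ofReal_le_ofReal h)
  rcases min_lt_iff.1 hd1 with h | h
  · exact dimH_approxSet_le_coe hτ2 hτ le_rfl h
  · exact dimH_approxSet_le_coe hτ2 le_rfl hτ (by rwa [add_sub_cancel_right])

/-- local Hausdorff dimension of `B_2(Ψ_τ)` for weights `τ1 ≥ τ2 ≥ 0`,
`τ1 + τ2 > 1`: for any ball `B ⊆ [0,1]²` of positive radius,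
`dim_H (B ∩ B_2(Ψ_τ)) = dim_H A_2(Ψ_τ) = min{(3+τ1-τ2)/(1+τ1), 3/(1+τ2)}`. -/
theorem stmt0 (τ1 τ2 : ℝ) (hτ : τ2 ≤ τ1) (hτ2 : 0 ≤ τ2) (hsum : 1 < τ1 + τ2)
    (x : Fin 2 → ℝ) (r : ℝ) (hr : 0 < r)
    (hB : Metric.closedBall x r ⊆ {y : Fin 2 → ℝ | ∀ i, y i ∈ Set.Icc (0:ℝ) 1}) :
    dimH (Metric.closedBall x r ∩ badSet 2 (psiTau 2 ![τ1, τ2])) =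
      ENNReal.ofReal (min ((3 + τ1 - τ2) / (1 + τ1)) (3 / (1 + τ2))) ∧
    dimH (approxSet 2 (psiTau 2 ![τ1, τ2])) =
      ENNReal.ofReal (min ((3 + τ1 - τ2) / (1 + τ1)) (3 / (1 + τ2))) := by
  have h₁ := le_dimH_inter_badSet hτ hτ2 hsum hr hB
  have h₂ : dimH (Metric.closedBall x r ∩ badSet 2 (psiTau 2 ![τ1, τ2])) ≤
      dimH (approxSet 2 (psiTau 2 ![τ1, τ2])) :=
    dimH_mono (inter_subset_right.trans sdiff_subset)
  have h₃ := dimH_approxSet_le hτ hτ2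
  exact ⟨(h₂.trans h₃).antisymm h₁, h₃.antisymm (h₁.trans h₂)⟩
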